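/- arXiv:2207.02839 — 6 statements merged into one kernel-verified Lean document; each statement's English description precedes it below -/
import Mathlib

section
/- Let Γ: ℝ^d × ℝ^d → (0,∞)^{m×m} be a conditionally negative definite matrix-valued kernel with strictly positive entries, let s > 0 and ν ≥ (d+1)/2. Then the matrix-valued kernel C: ℝ^d × ℝ^d → ℝ^{m×m} with entries C_ij(x,y) = s^{ν+1} · B(γ_ij(x,y)+1, ν+1) · max(1 − ‖x−y‖/s, 0)^{ν + γ_ij(x,y) + 1}, i,j = 1,…,m, where B(a,b) = Γ(a)Γ(b)/Γ(a+b) denotes the Beta function and ‖·‖ the Euclidean norm, is positive definite; moreover it is compactly supported, i.e., C_ij(x,y) = 0 whenever ‖x−y‖ ≥ s. -/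
open Matrix MeasureTheory Real Set
open scoped BigOperators

/-- A matrix-valued kernel `C : X × X → ℝ^{m×m}` is positive definite if it is symmetric
(`C_ij(x,y) = C_ji(y,x)`) and all quadratic forms `∑_p ∑_q a_pᵀ C(x_p, x_q) a_q` are
nonnegative. -/
def IsPosDefKernel {X : Type*} {m : ℕ} (C : X → X → Matrix (Fin m) (Fin m) ℝ) : Prop :=
  (∀ x y i j, C x y i j = C y x j i) ∧
  ∀ (n : ℕ) (x : Fin n → X) (a : Fin n → Fin m → ℝ),
    0 ≤ ∑ p, ∑ q, a p ⬝ᵥ (C (x p) (x q)).mulVec (a q)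

/-- A matrix-valued kernel `Γ : X × X → ℝ^{m×m}` is conditionally negative definite if it is
symmetric (`Γ_ij(x,y) = Γ_ji(y,x)`) and all quadratic forms `∑_p ∑_q a_pᵀ Γ(x_p, x_q) a_q`
with `1_mᵀ ∑_p a_p = 0` are nonpositive. -/
def IsCondNegDefKernel {X : Type*} {m : ℕ} (Γ : X → X → Matrix (Fin m) (Fin m) ℝ) : Prop :=
  (∀ x y i j, Γ x y i j = Γ y x j i) ∧
  ∀ (n : ℕ) (x : Fin n → X) (a : Fin n → Fin m → ℝ),
    (∑ p, ∑ i, a p i) = 0 →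
    ∑ p, ∑ q, a p ⬝ᵥ (Γ (x p) (x q)).mulVec (a q) ≤ 0

/-- A non-stationary pseudo cross-variogram: a conditionally negative definite matrix-valued
kernel vanishing on the diagonal of its diagonal components. -/
def IsNSPseudoCrossVariogram {X : Type*} {m : ℕ}
    (Γ : X → X → Matrix (Fin m) (Fin m) ℝ) : Prop :=
  IsCondNegDefKernel Γ ∧ ∀ x i, Γ x x i i = 0

/-- A matrix-valued function is positive definite if the associated translation-invariant
kernel `(x, y) ↦ C (x - y)` is a positive definite kernel. -/
def IsPosDefFun {V : Type*} [AddCommGroup V] {m : ℕ}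
    (C : V → Matrix (Fin m) (Fin m) ℝ) : Prop :=
  IsPosDefKernel (fun x y => C (x - y))

/-- A (stationary) pseudo cross-variogram: the kernel `(x,y) ↦ γ(x−y)` is conditionally
negative definite and `γ_ii(0) = 0` for all `i`. -/
def IsPseudoCrossVariogram {V : Type*} [AddCommGroup V] {m : ℕ}
    (γ : V → Matrix (Fin m) (Fin m) ℝ) : Prop :=
  IsCondNegDefKernel (fun x y => γ (x - y)) ∧ ∀ i, γ 0 i i = 0

theorem Matrix.posSemidef_real_iff {ι : Type*} [Fintype ι] {M : Matrix ι ι ℝ} :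
    M.PosSemidef ↔ (∀ i j, M i j = M j i) ∧
      ∀ a : ι → ℝ, 0 ≤ ∑ i, ∑ j, a i * a j * M i j := by
  rw [posSemidef_iff_dotProduct_mulVec]
  refine and_congr ?_ (forall_congr' fun a => ?_)
  · simp only [IsHermitian.ext_iff, star_trivial]
    exact ⟨fun h i j => h j i, fun h i j => h j i⟩
  · simp only [star_trivial, dotProduct, mulVec, Finset.mul_sum]
    refine iff_of_eq (congrArg _ (Finset.sum_congr rfl fun i _ => Finset.sum_congr rfl fun j _ => ?_))
    ring

theorem Matrix.PosSemidef.of_tendsto {ι α : Type*} [Fintype ι] {l : Filter α} [l.NeBot]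
    {A : α → Matrix ι ι ℝ} {M : Matrix ι ι ℝ} (hA : ∀ᶠ t in l, (A t).PosSemidef)
    (h : ∀ i j, Filter.Tendsto (fun t => A t i j) l (nhds (M i j))) : M.PosSemidef := by
  rw [posSemidef_real_iff]
  constructor
  · intro i j
    refine tendsto_nhds_unique_of_eventuallyEq (h i j) (h j i) ?_
    filter_upwards [hA] with t ht using (posSemidef_real_iff.1 ht).1 i j
  · intro a
    refine ge_of_tendsto (f := fun t => ∑ i, ∑ j, a i * a j * A t i j) (x := l) ?_ ?_
    · exact tendsto_finsetSum _ fun i _ => tendsto_finsetSum _ fun j _ => (h i j).const_mul _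
    · filter_upwards [hA] with t ht using (posSemidef_real_iff.1 ht).2 a

theorem Matrix.PosSemidef.of_integral {ι α : Type*} [Fintype ι] [MeasurableSpace α]
    {μ : Measure α} {A : α → Matrix ι ι ℝ} (hA : ∀ᵐ t ∂μ, (A t).PosSemidef)
    (h : ∀ i j, Integrable (fun t => A t i j) μ) :
    (Matrix.of fun i j => ∫ t, A t i j ∂μ).PosSemidef := by
  rw [posSemidef_real_iff]
  constructor
  · intro i j
    refine integral_congr_ae ?_
    filter_upwards [hA] with t ht using (posSemidef_real_iff.1 ht).1 i j
  · intro a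
    have : ∑ i, ∑ j, a i * a j * (Matrix.of fun i j => ∫ t, A t i j ∂μ) i j
        = ∫ t, ∑ i, ∑ j, a i * a j * A t i j ∂μ := by
      rw [integral_finsetSum _ fun i _ => integrable_finsetSum _ fun j _ => (h i j).const_mul _]
      refine Finset.sum_congr rfl fun i _ => ?_
      rw [integral_finsetSum _ fun j _ => (h i j).const_mul _]
      exact Finset.sum_congr rfl fun j _ => by rw [integral_const_mul]; rfl
    rw [this]
    refine integral_nonneg_of_ae ?_
    filter_upwards [hA] with t ht using (posSemidef_real_iff.1 ht).2 a

theorem Matrix.posSemidef_of_mul {ι : Type*} [Fintype ι] (b : ι → ℝ) :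
    (Matrix.of fun i j => b i * b j).PosSemidef := by
  refine posSemidef_real_iff.2 ⟨fun i j => mul_comm _ _, fun a => ?_⟩
  have : ∑ i, ∑ j, a i * a j * (Matrix.of fun i j => b i * b j) i j
      = (∑ i, a i * b i) * ∑ j, a j * b j := by
    rw [Finset.sum_mul_sum]
    exact Finset.sum_congr rfl fun i _ => Finset.sum_congr rfl fun j _ => by
      simp only [of_apply]; ring
  rw [this]
  exact mul_self_nonneg _

theorem Matrix.PosSemidef.of_mul {ι : Type*} {A B : Matrix ι ι ℝ}
    (hA : A.PosSemidef) (hB : B.PosSemidef) :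
    (Matrix.of fun i j => A i j * B i j).PosSemidef :=
  hA.hadamard hB

theorem Matrix.PosSemidef.of_mul_of_mul {ι : Type*} [Fintype ι] {M : Matrix ι ι ℝ}
    (hM : M.PosSemidef) (b : ι → ℝ) :
    (Matrix.of fun i j => b i * b j * M i j).PosSemidef :=
  (posSemidef_of_mul b).hadamard hM

theorem Matrix.PosSemidef.of_pow {ι : Type*} [Fintype ι] {M : Matrix ι ι ℝ}
    (hM : M.PosSemidef) (n : ℕ) : (Matrix.of fun i j => M i j ^ n).PosSemidef := by
  induction n with
  | zero => simpa using posSemidef_of_mul fun _ : ι => (1 : ℝ)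
  | succ n ih =>
    simp only [pow_succ]
    exact ih.hadamard hM

theorem Matrix.PosSemidef.of_exp {ι : Type*} [Fintype ι] {M : Matrix ι ι ℝ}
    (hM : M.PosSemidef) : (Matrix.of fun i j => Real.exp (M i j)).PosSemidef := by
  refine PosSemidef.of_tendsto (l := Filter.atTop)
    (A := fun N : ℕ => ∑ n ∈ Finset.range N,
      ((n.factorial : ℝ)⁻¹ • (Matrix.of fun i j => M i j ^ n : Matrix ι ι ℝ)))
    (Filter.Eventually.of_forall fun N => ?_) fun i j => ?_
  · exact posSemidef_sum _ fun n _ => (hM.of_pow n).smul (by positivity)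
  · have := (NormedSpace.expSeries_div_hasSum_exp (M i j)).tendsto_sum_nat
    rw [← Real.exp_eq_exp_ℝ] at this
    simpa [Matrix.sum_apply, div_eq_inv_mul] using this

theorem Matrix.posSemidef_exp_neg_of_condNegDef {ι : Type*} [Fintype ι] {G : Matrix ι ι ℝ}
    (hsymm : ∀ i j, G i j = G j i)
    (hG : ∀ a : ι → ℝ, ∑ i, a i = 0 → ∑ i, ∑ j, a i * a j * G i j ≤ 0) :
    (Matrix.of fun i j => Real.exp (-G i j)).PosSemidef := by
  classical
  rcases isEmpty_or_nonempty ι with _ | ⟨⟨o⟩⟩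
  · exact posSemidef_real_iff.2 ⟨fun i => isEmptyElim i, fun a => by simp⟩
  have hK : (Matrix.of fun i j => G i o + G j o - G i j - G o o).PosSemidef := by
    refine posSemidef_real_iff.2 ⟨fun i j => by simp only [of_apply, hsymm i j]; ring, fun a => ?_⟩
    have h := hG (a - Pi.single o (∑ i, a i)) (by simp)
    simp only [Pi.sub_apply, sub_mul, mul_sub, Finset.sum_sub_distrib, Pi.single_apply,
      ite_mul, mul_ite, zero_mul, mul_zero, Finset.sum_ite_eq', Finset.mem_univ, if_true,
      Finset.sum_const_zero, Finset.sum_ite_irrel] at h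
    simp only [of_apply, mul_sub, mul_add, Finset.sum_sub_distrib, Finset.sum_add_distrib]
    have e1 : ∑ i, ∑ j, a i * a j * G i o = (∑ i, a i) * ∑ i, a i * G i o := by
      rw [mul_comm, Finset.sum_mul_sum]
      exact Finset.sum_congr rfl fun i _ => Finset.sum_congr rfl fun j _ => by ring
    have e2 : ∑ i, ∑ j, a i * a j * G j o = (∑ i, a i) * ∑ i, a i * G i o := by
      rw [Finset.sum_mul_sum]
      exact Finset.sum_congr rfl fun i _ => Finset.sum_congr rfl fun j _ => by ring
    have e3 : ∑ i, ∑ j, a i * a j * G o o = (∑ i, a i) * (∑ i, a i) * G o o := by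
      rw [Finset.sum_mul_sum, Finset.sum_mul]
      exact Finset.sum_congr rfl fun i _ => by rw [Finset.sum_mul]
    have e4 : ∑ i, a i * (∑ i, a i) * G i o = (∑ i, a i) * ∑ i, a i * G i o := by
      rw [Finset.mul_sum]
      exact Finset.sum_congr rfl fun i _ => by ring
    have e5 : ∑ j, (∑ i, a i) * a j * G o j = (∑ i, a i) * ∑ i, a i * G i o := by
      rw [Finset.mul_sum]
      exact Finset.sum_congr rfl fun i _ => by rw [hsymm o i]; ring
    rw [e1, e2, e3]
    rw [e4, e5] at h
    linarith
  convert hK.of_exp.of_mul_of_mul fun i => Real.exp (G o o / 2 - G i o) using 1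
  ext i j
  simp only [of_apply, ← Real.exp_add]
  congr 1
  ring

theorem ofReal_cpow_mul_one_sub_cpow {x : ℝ} (hx : x ∈ Ioo (0 : ℝ) 1) (α β : ℝ) :
    (x : ℂ) ^ ((α : ℂ) - 1) * (1 - (x : ℂ)) ^ ((β : ℂ) - 1) =
      ((x ^ (α - 1) * (1 - x) ^ (β - 1) : ℝ) : ℂ) := by
  rw [Complex.ofReal_mul, Complex.ofReal_cpow hx.1.le, Complex.ofReal_cpow (sub_nonneg.2 hx.2.le)]
  push_cast
  rfl

theorem intervalIntegrable_rpow_mul_one_sub_rpow {α β : ℝ} (hα : 0 < α) (hβ : 0 < β) :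
    IntervalIntegrable (fun x : ℝ => x ^ (α - 1) * (1 - x) ^ (β - 1)) volume 0 1 := by
  have h := Complex.betaIntegral_convergent (u := α) (v := β) (by simpa) (by simpa)
  rw [intervalIntegrable_iff_integrableOn_Ioo_of_le zero_le_one] at h ⊢
  refine IntegrableOn.congr_fun (f := fun x : ℝ =>
    ((x : ℂ) ^ ((α : ℂ) - 1) * (1 - (x : ℂ)) ^ ((β : ℂ) - 1)).re) h.re (fun x hx => ?_)
    measurableSet_Ioo
  simp only [ofReal_cpow_mul_one_sub_cpow hx, Complex.ofReal_re]

theorem integral_rpow_mul_one_sub_rpow {α β : ℝ} (hα : 0 < α) (hβ : 0 < β) :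
    ∫ x in (0 : ℝ)..1, x ^ (α - 1) * (1 - x) ^ (β - 1) =
      Real.Gamma α * Real.Gamma β / Real.Gamma (α + β) := by
  have h := ProbabilityTheory.beta_eq_betaIntegralReal α β hα hβ
  rw [ProbabilityTheory.beta, Complex.betaIntegral,
    intervalIntegral.integral_of_le zero_le_one, integral_Ioc_eq_integral_Ioo,
    setIntegral_congr_fun measurableSet_Ioo fun x hx => ofReal_cpow_mul_one_sub_cpow hx α β,
    integral_complex_ofReal, Complex.ofReal_re] at h
  rw [h, intervalIntegral.integral_of_le zero_le_one, integral_Ioc_eq_integral_Ioo]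

/-- The truncated powers `(u - r)₊ ^ ν` mix to the truncated power `(1 - r / s)₊ ^ (ν + γ + 1)`. -/
theorem integrableOn_and_integral_truncated_rpow {s r ν γ : ℝ} (hs : 0 < s) (hr : 0 ≤ r)
    (hν : 0 < ν) (hγ : -1 < γ) :
    IntegrableOn (fun u => max (u - r) 0 ^ ν * (1 - u / s) ^ γ) (Ioo 0 s) ∧
    ∫ u in Ioo 0 s, max (u - r) 0 ^ ν * (1 - u / s) ^ γ =
      s ^ (ν + 1) * (Real.Gamma (γ + 1) * Real.Gamma (ν + 1) / Real.Gamma (γ + 1 + (ν + 1))) *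
        max (1 - r / s) 0 ^ (ν + γ + 1) := by
  have hzero : ∀ u, u ≤ r → max (u - r) 0 ^ ν * (1 - u / s) ^ γ = 0 := fun u hu => by
    rw [max_eq_right (by linarith), Real.zero_rpow hν.ne', zero_mul]
  rcases le_or_gt s r with hsr | hrs
  · have h0 : EqOn (fun _ => (0 : ℝ)) (fun u => max (u - r) 0 ^ ν * (1 - u / s) ^ γ) (Ioo 0 s) :=
      fun u hu => (hzero u (hu.2.le.trans hsr)).symm
    refine ⟨integrableOn_zero.congr_fun h0 measurableSet_Ioo, ?_⟩
    rw [← setIntegral_congr_fun measurableSet_Ioo h0, max_eq_right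
      (sub_nonpos.2 ((one_le_div hs).2 hsr)), Real.zero_rpow (by linarith)]
    simp
  · have hc : 0 < s - r := sub_pos.2 hrs
    set g : ℝ → ℝ := fun x => x ^ (ν + 1 - 1) * (1 - x) ^ (γ + 1 - 1) with hg
    have hgi := intervalIntegrable_rpow_mul_one_sub_rpow (α := ν + 1) (β := γ + 1)
      (by linarith) (by linarith)
    have hgI := integral_rpow_mul_one_sub_rpow (α := ν + 1) (β := γ + 1)
      (by linarith) (by linarith)
    rw [← hg] at hgi hgI
    have hsub : Ioo r s ⊆ Ioo 0 s := Ioo_subset_Ioo_left hr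
    have hout : ∀ u ∈ Ioo 0 s \ Ioo r s, max (u - r) 0 ^ ν * (1 - u / s) ^ γ = 0 :=
      fun u hu => hzero u (not_lt.1 fun h => hu.2 ⟨h, hu.1.2⟩)
    have heq : EqOn (fun u => (s - r) ^ ν * (1 - r / s) ^ γ * g (u / (s - r) - r / (s - r)))
        (fun u => max (u - r) 0 ^ ν * (1 - u / s) ^ γ) (Ioo r s) := fun u hu => by
      have h1 : 0 < u - r := sub_pos.2 hu.1
      have h2 : 0 < s - u := sub_pos.2 hu.2
      have e1 : u / (s - r) - r / (s - r) = (u - r) / (s - r) := by ring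
      have e2 : 1 - (u - r) / (s - r) = (s - u) / (s - r) := by field_simp; ring
      have e3 : 1 - r / s = (s - r) / s := by field_simp
      have e4 : 1 - u / s = (s - u) / s := by field_simp
      simp only [hg, add_sub_cancel_right, e1, e2, e3, e4, max_eq_left h1.le]
      rw [Real.div_rpow hc.le hs.le, Real.div_rpow h1.le hc.le, Real.div_rpow h2.le hc.le,
        Real.div_rpow h2.le hs.le]
      have := (Real.rpow_pos_of_pos hc ν).ne'
      have := (Real.rpow_pos_of_pos hc γ).ne'
      field_simp
    have hi : IntervalIntegrable (fun u => g (u / (s - r) - r / (s - r))) volume r s := by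
      have := (hgi.comp_sub_right (r / (s - r))).comp_mul_left (c := (s - r)⁻¹)
      convert this using 1
      · ext u; congr 1; ring
      · field_simp; ring
      · field_simp; ring
    have hI : ∫ u in r..s, g (u / (s - r) - r / (s - r)) = (s - r) * ∫ x in (0 : ℝ)..1, g x := by
      rw [intervalIntegral.integral_comp_div_sub g hc.ne', sub_self, ← sub_div, div_self hc.ne',
        smul_eq_mul]
    have hi' := ((intervalIntegrable_iff_integrableOn_Ioo_of_le hrs.le).1
      (hi.const_mul ((s - r) ^ ν * (1 - r / s) ^ γ))).congr_fun heq measurableSet_Ioo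
    refine ⟨hi'.of_forall_sdiff_eq_zero measurableSet_Ioo hout, ?_⟩
    rw [setIntegral_eq_of_subset_of_forall_sdiff_eq_zero measurableSet_Ioo hsub hout,
      ← setIntegral_congr_fun measurableSet_Ioo heq, ← integral_Ioc_eq_integral_Ioo,
      ← intervalIntegral.integral_of_le hrs.le, intervalIntegral.integral_const_mul, hI, hgI]
    have h1 : 0 < 1 - r / s := by rw [sub_pos, div_lt_one hs]; exact hrs
    have e : s - r = s * (1 - r / s) := by field_simp
    rw [max_eq_left h1.le, add_comm (γ + 1) (ν + 1), e, Real.mul_rpow hs.le h1.le,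
      Real.rpow_add h1, Real.rpow_add h1, Real.rpow_add hs, Real.rpow_one, Real.rpow_one]
    ring

/-- Mixing a positive semidefinite family of truncated powers over the truncation radius, with
weights coming from a conditionally negative definite matrix of exponents. -/
theorem Matrix.posSemidef_beta_mul_truncated_rpow {ι : Type*} [Fintype ι] {D G : ι → ι → ℝ}
    {s ν : ℝ} (hs : 0 < s) (hν : 0 < ν) (hD : ∀ i j, 0 ≤ D i j)
    (hpsd : ∀ u, 0 < u → (Matrix.of fun i j => max (u - D i j) 0 ^ ν).PosSemidef)
    (hG1 : ∀ i j, -1 < G i j) (hsymm : ∀ i j, G i j = G j i)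
    (hG : ∀ a : ι → ℝ, ∑ i, a i = 0 → ∑ i, ∑ j, a i * a j * G i j ≤ 0) :
    (Matrix.of fun i j => s ^ (ν + 1) *
      (Real.Gamma (G i j + 1) * Real.Gamma (ν + 1) / Real.Gamma (G i j + 1 + (ν + 1))) *
        max (1 - D i j / s) 0 ^ (ν + G i j + 1)).PosSemidef := by
  have h := fun i j => integrableOn_and_integral_truncated_rpow hs (hD i j) hν (hG1 i j)
  simp only [← (h _ _).2]
  refine PosSemidef.of_integral (μ := volume.restrict (Ioo 0 s))
    (A := fun u => Matrix.of fun i j => max (u - D i j) 0 ^ ν * (1 - u / s) ^ G i j)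
    ?_ fun i j => (h i j).1
  refine (ae_restrict_iff' measurableSet_Ioo).2 (Filter.Eventually.of_forall fun u hu => ?_)
  have h1 : 0 < 1 - u / s := by rw [sub_pos, div_lt_one hs]; exact hu.2
  have h2 : 0 ≤ -Real.log (1 - u / s) := by
    rw [neg_nonneg]
    exact Real.log_nonpos h1.le (by linarith [div_pos hu.1 hs])
  have h3 := posSemidef_exp_neg_of_condNegDef (G := -Real.log (1 - u / s) • G)
    (fun i j => by simp [hsymm i j]) fun a ha => by
      have e : ∑ i, ∑ j, a i * a j * (-Real.log (1 - u / s) • G) i j =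
          -Real.log (1 - u / s) * ∑ i, ∑ j, a i * a j * G i j := by
        simp only [Finset.mul_sum, Pi.smul_apply, smul_eq_mul]
        exact Finset.sum_congr rfl fun i _ => Finset.sum_congr rfl fun j _ => by ring
      rw [e]
      exact mul_nonpos_of_nonneg_of_nonpos h2 (hG a ha)
  convert (hpsd u hu.1).of_mul h3 using 1
  ext i j
  simp [Real.rpow_def_of_pos h1]

theorem abs_add_sq_add_lt_iff {t h b : ℝ} (hh : 0 ≤ h) :
    (|t| + h) ^ 2 + b < 1 ↔ (t - h) ^ 2 + b < 1 ∧ (t + h) ^ 2 + b < 1 := by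
  have := mul_nonneg (abs_nonneg t) hh
  have := mul_le_mul_of_nonneg_right (le_abs_self t) hh
  have := mul_le_mul_of_nonneg_right (neg_abs_le t) hh
  have := sq_abs t
  constructor
  · intro H
    constructor <;> nlinarith
  · rintro ⟨h1, h2⟩
    rcases abs_cases t with ⟨h, _⟩ | ⟨h, _⟩ <;> rw [h] <;> nlinarith

theorem exists_measurePreserving_prod_euclideanSpace (k : ℕ) :
    ∃ Φ : EuclideanSpace ℝ (Fin (k + 1)) → ℝ × EuclideanSpace ℝ (Fin k),
      MeasurePreserving Φ volume volume ∧ (∀ z, (Φ z).1 = z 0) ∧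
      ∀ z, ‖(Φ z).2‖ ^ 2 = ∑ i : Fin k, z i.succ ^ 2 := by
  refine ⟨fun z => (z 0, WithLp.toLp 2 fun i => z i.succ), ?_, fun z => rfl, fun z => ?_⟩
  · have h1 := PiLp.volume_preserving_ofLp (Fin (k + 1))
    have h2 := volume_preserving_piFinSuccAbove (fun _ : Fin (k + 1) => ℝ) 0
    have h3 := (MeasurePreserving.id (volume : Measure ℝ)).prod
      (PiLp.volume_preserving_toLp (Fin k))
    exact h3.comp (h2.comp h1)
  · simp [EuclideanSpace.norm_sq_eq]

theorem exists_volume_ball_inter_ball (k : ℕ) :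
    ∃ c : ℝ, 0 < c ∧ ∀ x y : EuclideanSpace ℝ (Fin (k + 1)),
      volume.real (Metric.ball x 1 ∩ Metric.ball y 1) =
        c * ∫ t in (min (‖x - y‖ / 2) 1)..1, √(1 - t ^ 2) ^ k := by
  set ω : ℝ := volume.real (Metric.ball (0 : EuclideanSpace ℝ (Fin k)) 1) with hω
  have hω0 : 0 < ω := by
    rw [hω, measureReal_def]
    exact ENNReal.toReal_pos (Metric.measure_ball_pos _ _ one_pos).ne' measure_ball_lt_top.ne
  refine ⟨2 * ω, by positivity, fun x y => ?_⟩
  set h : ℝ := ‖x - y‖ / 2 with hh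
  have hh0 : 0 ≤ h := by positivity
  set e : EuclideanSpace ℝ (Fin (k + 1)) := EuclideanSpace.single 0 1 with he
  obtain ⟨Φ, hΦ, hΦ1, hΦ2⟩ := exists_measurePreserving_prod_euclideanSpace k
  set T : Set (ℝ × EuclideanSpace ℝ (Fin k)) := {p | (|p.1| + h) ^ 2 + ‖p.2‖ ^ 2 < 1} with hT
  have hTm : MeasurableSet T :=
    (isOpen_lt (by fun_prop) continuous_const).measurableSet
  have hnorm : ‖(1 / 2 : ℝ) • (x - y)‖ = ‖h • e‖ := by
    rw [norm_smul, norm_smul, he, PiLp.norm_single, hh]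
    simp
    ring
  set L := Submodule.reflection (ℝ ∙ ((1 / 2 : ℝ) • (x - y) - h • e))ᗮ with hL
  have hLv : L ((1 / 2 : ℝ) • (x - y)) = h • e := Submodule.reflection_sub hnorm
  set c : EuclideanSpace ℝ (Fin (k + 1)) := (1 / 2 : ℝ) • (x + y) with hc
  have hpre : (fun z => L (z - c)) ⁻¹' (Φ ⁻¹' T) = Metric.ball x 1 ∩ Metric.ball y 1 := by
    ext z
    have key : ∀ w : EuclideanSpace ℝ (Fin (k + 1)),
        w ∈ Φ ⁻¹' T ↔ ‖w - h • e‖ < 1 ∧ ‖w + h • e‖ < 1 := by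
      intro w
      have e1 : ∀ w : EuclideanSpace ℝ (Fin (k + 1)), ‖w‖ < 1 ↔ ‖w‖ ^ 2 < 1 := fun w => by
        rw [sq_lt_one_iff₀ (norm_nonneg _)]
      rw [e1, e1, EuclideanSpace.norm_sq_eq, EuclideanSpace.norm_sq_eq, Fin.sum_univ_succ,
        Fin.sum_univ_succ]
      simp only [mem_preimage, hT, mem_ofPred_eq, hΦ1, hΦ2]
      rw [abs_add_sq_add_lt_iff hh0]
      simp [he]
    rw [mem_preimage, key, ← hLv, ← map_sub, ← map_add, LinearIsometryEquiv.norm_map,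
      LinearIsometryEquiv.norm_map, mem_inter_iff, mem_ball_iff_norm, mem_ball_iff_norm]
    have e1 : z - c - (1 / 2 : ℝ) • (x - y) = z - x := by rw [hc]; module
    have e2 : z - c + (1 / 2 : ℝ) • (x - y) = z - y := by rw [hc]; module
    rw [e1, e2]
  have hmp : MeasurePreserving (fun z => Φ (L (z - c))) volume volume :=
    hΦ.comp (L.measurePreserving.comp (measurePreserving_sub_right volume c))
  have hvol : volume (Metric.ball x 1 ∩ Metric.ball y 1) = volume T := by
    rw [← hpre]
    exact hmp.measure_preimage hTm.nullMeasurableSet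
  set f : ℝ → ℝ := (Iio (1 - h)).indicator fun t => √(1 - (t + h) ^ 2) ^ k with hf
  have hf0 : ∀ t, 0 ≤ f t := fun t => indicator_nonneg (fun _ _ => by positivity) _
  have hfm : Measurable f := by
    refine Measurable.indicator ?_ measurableSet_Iio
    fun_prop
  have hsec : ∀ t : ℝ, volume (Prod.mk t ⁻¹' T) = ENNReal.ofReal (f |t| * ω) := by
    intro t
    by_cases ht : |t| < 1 - h
    · have h1 : 0 < 1 - (|t| + h) ^ 2 := by nlinarith [abs_nonneg t]
      have : Prod.mk t ⁻¹' T = Metric.ball 0 (√(1 - (|t| + h) ^ 2)) := by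
        ext w
        simp only [hT, mem_preimage, mem_ofPred_eq, mem_ball_zero_iff]
        rw [Real.lt_sqrt (norm_nonneg _)]
        constructor <;> intro <;> linarith
      rw [this, Measure.addHaar_ball_of_pos _ _ (Real.sqrt_pos.2 h1), hf,
        indicator_of_mem (mem_Iio.2 ht), ENNReal.ofReal_mul (by positivity), hω,
        ofReal_measureReal measure_ball_lt_top.ne]
      simp
    · have : Prod.mk t ⁻¹' T = ∅ := by
        ext w
        simp only [hT, mem_preimage, mem_ofPred_eq, mem_empty_iff_false, iff_false, not_lt]
        nlinarith [sq_nonneg ‖w‖]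
      rw [this, hf, indicator_of_notMem (by simpa using ht)]
      simp
  have hTv : volume.real T = ω * ∫ t, f |t| := by
    rw [measureReal_def, Measure.volume_eq_prod, Measure.prod_apply hTm, lintegral_congr hsec,
      ← integral_eq_lintegral_of_nonneg_ae, integral_mul_const, mul_comm]
    · exact Filter.Eventually.of_forall fun t => mul_nonneg (hf0 _) hω0.le
    · exact ((hfm.comp measurable_abs).mul_const _).aestronglyMeasurable
  rw [measureReal_def, hvol, ← measureReal_def, hTv, integral_comp_abs, hf,
    setIntegral_indicator measurableSet_Iio, Ioi_inter_Iio]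
  rcases le_or_gt 1 h with h1 | h1
  · rw [min_eq_right h1, Ioo_eq_empty (by linarith)]
    simp
  · rw [min_eq_left h1.le, ← integral_Ioc_eq_integral_Ioo,
      ← intervalIntegral.integral_of_le (by linarith),
      intervalIntegral.integral_comp_add_right (fun t => √(1 - t ^ 2) ^ k)]
    simp
    ring

theorem exists_euclideanSpace_isometric_copy {ι : Type*} {d N : ℕ} (hdN : d ≤ N)
    (x : ι → EuclideanSpace ℝ (Fin d)) :
    ∃ x' : ι → EuclideanSpace ℝ (Fin N), ∀ i j, ‖x' i - x' j‖ = ‖x i - x j‖ := by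
  induction N, hdN using Nat.le_induction with
  | base => exact ⟨x, fun _ _ => rfl⟩
  | succ N _ ih =>
    obtain ⟨y, hy⟩ := ih
    refine ⟨fun i => WithLp.toLp 2 (Fin.cons 0 (y i)), fun i j => ?_⟩
    rw [← hy, EuclideanSpace.norm_eq, EuclideanSpace.norm_eq, Fin.sum_univ_succ]
    simp

/-- Euclid's hat in dimension `N + 1`, restricted to `ℝ ^ d` with `d ≤ N + 1`. -/
theorem posSemidef_euclid_hat {ι : Type*} [Fintype ι] {d N : ℕ} (hdN : d ≤ N + 1)
    (x : ι → EuclideanSpace ℝ (Fin d)) :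
    (Matrix.of fun i j =>
      ∫ t in (min ‖x i - x j‖ 1)..1, √(1 - t ^ 2) ^ N).PosSemidef := by
  obtain ⟨y, hy⟩ := exists_euclideanSpace_isometric_copy hdN x
  obtain ⟨c, hc, hvol⟩ := exists_volume_ball_inter_ball N
  set B : ι → Set (EuclideanSpace ℝ (Fin (N + 1))) := fun i => Metric.ball ((2 : ℝ) • y i) 1
  have hB : ∀ i j z, (B i).indicator (1 : EuclideanSpace ℝ (Fin (N + 1)) → ℝ) z * (B j).indicator 1 z =
      (B i ∩ B j).indicator 1 z := fun i j z => by rw [inter_indicator_one, Pi.mul_apply]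
  have hBm : ∀ i j, MeasurableSet (B i ∩ B j) := fun i j =>
    measurableSet_ball.inter measurableSet_ball
  have h : (Matrix.of fun i j => ∫ z, (B i).indicator 1 z * (B j).indicator 1 z :
      Matrix ι ι ℝ).PosSemidef := by
    refine PosSemidef.of_integral
      (A := fun z => Matrix.of fun i j => (B i).indicator 1 z * (B j).indicator 1 z)
      (Filter.Eventually.of_forall fun z => posSemidef_of_mul _) fun i j => ?_
    simp only [of_apply, hB]
    exact (integrable_indicator_iff (hBm i j)).2 (integrableOn_const
      ((measure_mono inter_subset_left).trans_lt measure_ball_lt_top).ne)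
  convert h.smul (inv_nonneg.2 hc.le) using 1
  ext i j
  have h2 : ‖(2 : ℝ) • y i - (2 : ℝ) • y j‖ / 2 = ‖x i - x j‖ := by
    rw [← smul_sub, norm_smul, ← hy]; simp
  simp only [Matrix.smul_apply, of_apply, smul_eq_mul, hB]
  rw [integral_indicator_one (hBm i j), hvol, h2, inv_mul_cancel_left₀ hc.ne']

/-- The closure, in `C([0, 1])`, of the polynomials in `1 - v ^ 2` with nonnegative coefficients. -/
noncomputable def oneSubSqCone : Subsemiring C(unitInterval, ℝ) :=
  (Polynomial.eval₂RingHom ((algebraMap ℝ C(unitInterval, ℝ)).comp NNReal.toRealHom)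
    (⟨fun v => 1 - (v : ℝ) ^ 2, by fun_prop⟩ : C(unitInterval, ℝ))).rangeS.topologicalClosure

theorem isClosed_oneSubSqCone : IsClosed (oneSubSqCone : Set C(unitInterval, ℝ)) :=
  Subsemiring.isClosed_topologicalClosure _

theorem algebraMap_mem_oneSubSqCone {a : ℝ} (ha : 0 ≤ a) :
    algebraMap ℝ C(unitInterval, ℝ) a ∈ oneSubSqCone :=
  Subsemiring.le_topologicalClosure _ ⟨Polynomial.C a.toNNReal, by simp [ha]⟩

theorem oneSubSq_mem_oneSubSqCone :
    (⟨fun v => 1 - (v : ℝ) ^ 2, by fun_prop⟩ : C(unitInterval, ℝ)) ∈ oneSubSqCone :=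
  Subsemiring.le_topologicalClosure _ ⟨Polynomial.X, by simp⟩

/-- A closed subsemiring of continuous functions containing the nonnegative constants is stable
under `g ↦ 1 - √(1 - g)`, by Visser's iteration `p ↦ (g + p ^ 2) / 2`. -/
theorem one_sub_sqrt_one_sub_mem {X : Type*} [TopologicalSpace X] [CompactSpace X]
    {Q : Subsemiring C(X, ℝ)} (hQ : IsClosed (Q : Set C(X, ℝ)))
    (hconst : ∀ a : ℝ, 0 ≤ a → algebraMap ℝ C(X, ℝ) a ∈ Q)
    {g : C(X, ℝ)} (hg : g ∈ Q) (hg0 : ∀ x, 0 ≤ g x) (hg1 : ∀ x, g x ≤ 1) :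
    (⟨fun x => 1 - √(1 - g x), by fun_prop⟩ : C(X, ℝ)) ∈ Q := by
  set p : ℕ → C(X, ℝ) := fun n =>
    Nat.rec 0 (fun _ q => algebraMap ℝ C(X, ℝ) (1 / 2) * (g + q ^ 2)) n with hp
  have hp_succ : ∀ n, p (n + 1) = algebraMap ℝ C(X, ℝ) (1 / 2) * (g + p n ^ 2) := fun n => rfl
  have hmem : ∀ n, p n ∈ Q := fun n => by
    induction n with
    | zero => exact Q.zero_mem
    | succ n ih =>
      rw [hp_succ]
      exact Q.mul_mem (hconst _ (by norm_num)) (Q.add_mem hg (Q.pow_mem ih 2))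
  have hbound : ∀ n x, 0 ≤ p n x ∧ p n x ≤ 1 - √(1 - g x) ∧
      1 - √(1 - g x) - p n x ≤ 2 / ((n : ℝ) + 1) := fun n x => by
    have hs0 := Real.sqrt_nonneg (1 - g x)
    have hs1 : √(1 - g x) ≤ 1 := Real.sqrt_le_one.2 (by linarith [hg0 x])
    have hs2 := Real.sq_sqrt (sub_nonneg.2 (hg1 x))
    induction n with
    | zero =>
      have : p 0 x = 0 := rfl
      rw [this]
      refine ⟨le_rfl, by linarith, ?_⟩
      norm_num
      linarith
    | succ n ih =>
      obtain ⟨h0, h1, h2⟩ := ih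
      have e : p (n + 1) x = (g x + p n x ^ 2) / 2 := by
        rw [hp_succ]
        simp [Algebra.algebraMap_eq_smul_one]
        ring
      set r := √(1 - g x)
      have hgr : g x = 1 - r ^ 2 := by linarith
      rw [e, hgr]
      refine ⟨by nlinarith, by nlinarith, ?_⟩
      set δ := 1 - r - p n x with hδ
      have e2 : 1 - r - (1 - r ^ 2 + p n x ^ 2) / 2 ≤ δ - δ ^ 2 / 2 := by
        have : p n x = 1 - r - δ := by rw [hδ]; ring
        rw [this]
        nlinarith
      refine e2.trans ?_
      push_cast
      rcases Nat.eq_zero_or_pos n with rfl | hn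
      · norm_num
        nlinarith [sq_nonneg (δ - 1)]
      · have hn1 : (1 : ℝ) ≤ n := by exact_mod_cast hn
        have hm : 2 / ((n : ℝ) + 1) ≤ 1 := by rw [div_le_one (by linarith)]; linarith
        have h3 : δ - δ ^ 2 / 2 ≤ 2 / ((n : ℝ) + 1) - (2 / ((n : ℝ) + 1)) ^ 2 / 2 := by
          nlinarith
        refine h3.trans ?_
        have h4 : 2 / ((n : ℝ) + 1 + 1) - (2 / ((n : ℝ) + 1) - (2 / ((n : ℝ) + 1)) ^ 2 / 2) =
            2 / (((n : ℝ) + 1) ^ 2 * ((n : ℝ) + 1 + 1)) := by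
          field_simp
          ring
        have h5 : 0 ≤ 2 / (((n : ℝ) + 1) ^ 2 * ((n : ℝ) + 1 + 1)) := by positivity
        linarith
  refine hQ.mem_of_tendsto (b := Filter.atTop) (f := p) ?_ (Filter.Eventually.of_forall hmem)
  rw [tendsto_iff_dist_tendsto_zero]
  refine squeeze_zero (fun _ => dist_nonneg) (g := fun n : ℕ => 2 / ((n : ℝ) + 1)) (fun n => ?_) ?_
  · rw [ContinuousMap.dist_le (by positivity)]
    intro x
    obtain ⟨-, h1, h2⟩ := hbound n x
    rw [dist_comm, Real.dist_eq, ContinuousMap.coe_mk, abs_of_nonneg (by linarith)]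
    exact h2
  · simpa [div_eq_mul_inv] using (tendsto_one_div_add_atTop_nhds_zero_nat (𝕜 := ℝ)).const_mul 2

theorem inv_one_sub_mem {X : Type*} [TopologicalSpace X] [CompactSpace X]
    {Q : Subsemiring C(X, ℝ)} (hQ : IsClosed (Q : Set C(X, ℝ))) {e q : C(X, ℝ)} (he : e ∈ Q)
    (hnorm : ‖e‖ < 1) (hq : ∀ x, q x * (1 - e x) = 1) : q ∈ Q := by
  have hsum := (summable_geometric_of_norm_lt_one hnorm).hasSum.tendsto_sum_nat
  have h1 := geom_series_mul_neg e hnorm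
  have hq' : q = ∑' n : ℕ, e ^ n := by
    have h2 : (1 - e) * q = 1 := by
      ext x
      simpa [mul_comm] using hq x
    calc q = (∑' n : ℕ, e ^ n) * (1 - e) * q := by rw [h1, one_mul]
      _ = ∑' n : ℕ, e ^ n := by rw [mul_assoc, h2, mul_one]
  rw [hq']
  exact hQ.mem_of_tendsto hsum (Filter.Eventually.of_forall fun n =>
    Q.sum_mem fun i _ => Q.pow_mem he i)

theorem inv_sqrt_mem_oneSubSqCone :
    (⟨fun v => (√((1 + (v : ℝ)) / 2))⁻¹, by
      have : ∀ v : unitInterval, √((1 + (v : ℝ)) / 2) ≠ 0 := fun v =>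
        (Real.sqrt_pos.2 (by linarith [v.2.1])).ne'
      fun_prop (disch := simpa)⟩ : C(unitInterval, ℝ)) ∈ oneSubSqCone := by
  have h1 := one_sub_sqrt_one_sub_mem isClosed_oneSubSqCone
    (fun a => algebraMap_mem_oneSubSqCone) oneSubSq_mem_oneSubSqCone
    (fun v => by simp only [ContinuousMap.coe_mk]; nlinarith [v.2.1, v.2.2])
    (fun v => by simp only [ContinuousMap.coe_mk]; nlinarith [v.2.1, v.2.2])
  have h2 := oneSubSqCone.mul_mem (algebraMap_mem_oneSubSqCone (a := 1 / 2) (by norm_num)) h1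
  set g := algebraMap ℝ C(unitInterval, ℝ) (1 / 2) * (⟨_, _⟩ : C(unitInterval, ℝ)) with hg
  have hgv : ∀ v, 1 - g v = (1 + (v : ℝ)) / 2 := fun v => by
    simp only [hg, ContinuousMap.coe_mk, ContinuousMap.mul_apply, sub_sub_cancel,
      Real.sqrt_sq v.2.1]
    simp [Algebra.algebraMap_eq_smul_one]
    ring
  have h3 := one_sub_sqrt_one_sub_mem isClosed_oneSubSqCone
    (fun a => algebraMap_mem_oneSubSqCone) h2
    (fun v => by linarith [hgv v, v.2.1, v.2.2]) (fun v => by linarith [hgv v, v.2.1, v.2.2])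
  refine inv_one_sub_mem isClosed_oneSubSqCone h3 ?_ fun v => ?_
  · refine lt_of_le_of_lt ((ContinuousMap.norm_le _ (C := 1 / 2) (by norm_num)).2 fun v => ?_)
      (by norm_num)
    have h4 : √((1 + (v : ℝ)) / 2) ≤ 1 := Real.sqrt_le_one.2 (by linarith [v.2.2])
    have h5 : 1 / 2 ≤ √((1 + (v : ℝ)) / 2) := Real.le_sqrt_of_sq_le (by linarith [v.2.1])
    rw [ContinuousMap.coe_mk, hgv, Real.norm_eq_abs, abs_le]
    constructor <;> linarith
  · rw [ContinuousMap.coe_mk, ContinuousMap.coe_mk, hgv, sub_sub_cancel]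
    exact inv_mul_cancel₀ (Real.sqrt_pos.2 (by linarith [v.2.1])).ne'

theorem posSemidef_truncated_rpow_of_unit {ι : Type*} [Fintype ι] {d : ℕ} {ν : ℝ}
    (h : ∀ x : ι → EuclideanSpace ℝ (Fin d),
      (Matrix.of fun i j => max (1 - ‖x i - x j‖) 0 ^ ν).PosSemidef)
    (x : ι → EuclideanSpace ℝ (Fin d)) {u : ℝ} (hu : 0 < u) :
    (Matrix.of fun i j => max (u - ‖x i - x j‖) 0 ^ ν).PosSemidef := by
  convert (h fun i => u⁻¹ • x i).smul (Real.rpow_nonneg hu.le ν) using 1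
  ext i j
  simp only [of_apply, Matrix.smul_apply, smul_eq_mul]
  rw [← Real.mul_rpow hu.le (le_max_right _ _), mul_max_of_nonneg _ _ hu.le, mul_zero, mul_sub,
    ← smul_sub, norm_smul, norm_inv, Real.norm_of_nonneg hu.le, mul_inv_cancel_left₀ hu.ne',
    mul_one]

/-- Membership in the cone turns Euclid's hats into a further positive semidefinite matrix. -/
theorem posSemidef_integral_of_mem_oneSubSqCone {ι : Type*} [Fintype ι] {k : ℕ}
    (x : ι → EuclideanSpace ℝ (Fin (k + 1))) {q : C(unitInterval, ℝ)} (hq : q ∈ oneSubSqCone) :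
    (Matrix.of fun i j => ∫ t in (min ‖x i - x j‖ 1)..1,
      √(1 - t ^ 2) ^ k * q (projIcc 0 1 zero_le_one t)).PosSemidef := by
  have hii : ∀ (q : C(unitInterval, ℝ)) (a b : ℝ), IntervalIntegrable
      (fun t => √(1 - t ^ 2) ^ k * q (projIcc 0 1 zero_le_one t)) volume a b := fun q a b => by
    apply Continuous.intervalIntegrable
    fun_prop
  rw [oneSubSqCone, ← SetLike.mem_coe, Subsemiring.topologicalClosure_coe,
    mem_closure_iff_seq_limit] at hq
  obtain ⟨u, hu, hlim⟩ := hq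
  refine PosSemidef.of_tendsto (l := Filter.atTop) (A := fun n => Matrix.of fun i j =>
    ∫ t in (min ‖x i - x j‖ 1)..1, √(1 - t ^ 2) ^ k * u n (projIcc 0 1 zero_le_one t))
    (Filter.Eventually.of_forall fun n => ?_) fun i j => ?_
  · obtain ⟨P, hP⟩ := hu n
    simp only [← hP]
    clear hP
    induction P using Polynomial.induction_on' with
    | add P₁ P₂ h₁ h₂ =>
      convert h₁.add h₂ using 1
      ext i j
      simp only [of_apply, map_add, Matrix.add_apply, ContinuousMap.add_apply, mul_add]
      exact intervalIntegral.integral_add (hii _ _ _) (hii _ _ _)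
    | monomial m a =>
      convert (posSemidef_euclid_hat (N := k + 2 * m) (by omega) x).smul a.2 using 1
      ext i j
      simp only [of_apply, Matrix.smul_apply, smul_eq_mul]
      rw [← intervalIntegral.integral_const_mul]
      refine intervalIntegral.integral_congr fun t ht => ?_
      rw [uIcc_of_le (min_le_right _ _)] at ht
      have ht0 : 0 ≤ t := (le_min (norm_nonneg _) zero_le_one).trans ht.1
      have ht1 : 0 ≤ 1 - t ^ 2 := by nlinarith [ht.2]
      simp only [Polynomial.coe_eval₂RingHom, Polynomial.eval₂_monomial, pow_add, pow_mul,
        Real.sq_sqrt ht1, projIcc_of_mem zero_le_one ⟨ht0, ht.2⟩]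
      simp [Algebra.algebraMap_eq_smul_one]
      ring
  · have hcont : Continuous fun q : C(unitInterval, ℝ) =>
        ∫ t in (min ‖x i - x j‖ 1)..1, √(1 - t ^ 2) ^ k * q (projIcc 0 1 zero_le_one t) := by
      apply intervalIntegral.continuous_parametric_intervalIntegral_of_continuous'
      fun_prop
    exact (hcont.tendsto q).comp hlim

theorem integral_sqrt_one_sub_pow {r : ℝ} (k : ℕ) :
    ∫ t in (min r 1)..1, √(1 - t) ^ k =
      max (1 - r) 0 ^ ((k : ℝ) / 2 + 1) / ((k : ℝ) / 2 + 1) := by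
  have hk : (0 : ℝ) < (k : ℝ) / 2 + 1 := by positivity
  have hm : 1 - min r 1 = max (1 - r) 0 := by
    rcases le_total r 1 with h | h
    · rw [min_eq_left h, max_eq_left (by linarith)]
    · rw [min_eq_right h, max_eq_right (by linarith), sub_self]
  rw [intervalIntegral.integral_comp_sub_left (fun t => √t ^ k) 1, sub_self, hm]
  have h : ∫ t in (0 : ℝ)..(max (1 - r) 0), √t ^ k =
      ∫ t in (0 : ℝ)..(max (1 - r) 0), t ^ ((k : ℝ) / 2) := by
    refine intervalIntegral.integral_congr fun t ht => ?_
    rw [uIcc_of_le (le_max_right _ _)] at ht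
    simp only [Real.sqrt_eq_rpow]
    rw [← Real.rpow_mul_natCast ht.1]
    congr 1
    ring
  rw [h, integral_rpow (Or.inl (by have := hk; linarith)), Real.zero_rpow hk.ne', sub_zero]

/-- Askey's function `(1 - r)₊ ^ ((d + 1) / 2)` is positive definite on `ℝ ^ d`, `d = k + 1`. -/
theorem posSemidef_askey_critical {ι : Type*} [Fintype ι] {k : ℕ}
    (x : ι → EuclideanSpace ℝ (Fin (k + 1))) :
    (Matrix.of fun i j => max (1 - ‖x i - x j‖) 0 ^ ((k : ℝ) / 2 + 1)).PosSemidef := by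
  have h := posSemidef_integral_of_mem_oneSubSqCone x
    (oneSubSqCone.pow_mem inv_sqrt_mem_oneSubSqCone k)
  convert h.smul (show 0 ≤ ((k : ℝ) / 2 + 1) / √2 ^ k by positivity) using 1
  ext i j
  have e : ∫ t in (min ‖x i - x j‖ 1)..1, √(1 - t ^ 2) ^ k *
      (√((1 + ((projIcc 0 1 zero_le_one t : unitInterval) : ℝ)) / 2))⁻¹ ^ k =
      √2 ^ k * ∫ t in (min ‖x i - x j‖ 1)..1, √(1 - t) ^ k := by
    rw [← intervalIntegral.integral_const_mul]
    refine intervalIntegral.integral_congr fun t ht => ?_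
    rw [uIcc_of_le (min_le_right _ _)] at ht
    have ht0 : 0 ≤ t := (le_min (norm_nonneg _) zero_le_one).trans ht.1
    have ht1 : 0 < (1 + t) / 2 := by linarith
    have h2 : 1 - t ^ 2 = 2 * (1 - t) * ((1 + t) / 2) := by ring
    simp only [projIcc_of_mem zero_le_one ⟨ht0, ht.2⟩]
    rw [← mul_pow, ← mul_pow, h2, Real.sqrt_mul (by linarith [ht.2]), Real.sqrt_mul (by norm_num),
      mul_inv_cancel_right₀ (Real.sqrt_pos.2 ht1).ne']
  simp only [of_apply, Matrix.smul_apply, smul_eq_mul, ContinuousMap.pow_apply,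
    ContinuousMap.coe_mk]
  rw [e, integral_sqrt_one_sub_pow]
  field_simp

theorem posSemidef_askey {ι : Type*} [Fintype ι] {d : ℕ} {ν : ℝ} (hν : ((d : ℝ) + 1) / 2 ≤ ν)
    (x : ι → EuclideanSpace ℝ (Fin d)) :
    (Matrix.of fun i j => max (1 - ‖x i - x j‖) 0 ^ ν).PosSemidef := by
  rcases d with _ | k
  · simpa [Subsingleton.elim (x _) 0] using posSemidef_of_mul fun _ : ι => (1 : ℝ)
  have hk : (0 : ℝ) < (k : ℝ) / 2 + 1 := by positivity
  rw [show (((k + 1 : ℕ) : ℝ) + 1) / 2 = (k : ℝ) / 2 + 1 by push_cast; ring] at hν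
  rcases hν.eq_or_lt with rfl | hlt
  · exact posSemidef_askey_critical x
  set γ : ℝ := ν - ((k : ℝ) / 2 + 1) - 1 with hγ
  have hγ1 : -1 < γ := by linarith
  have h := posSemidef_beta_mul_truncated_rpow (D := fun i j => ‖x i - x j‖)
    (G := fun _ _ => γ) one_pos hk (fun i j => norm_nonneg _)
    (fun u hu => posSemidef_truncated_rpow_of_unit posSemidef_askey_critical x hu)
    (fun _ _ => hγ1) (fun _ _ => rfl) fun a ha => by
      simp only [← Finset.sum_mul, ← Finset.mul_sum, ha]
      simp
  set b := Real.Gamma (γ + 1) * Real.Gamma ((k : ℝ) / 2 + 1 + 1) /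
    Real.Gamma (γ + 1 + ((k : ℝ) / 2 + 1 + 1)) with hb
  have hb0 : 0 < b := ProbabilityTheory.beta_pos (by linarith) (by linarith)
  convert h.smul (inv_nonneg.2 hb0.le) using 1
  ext i j
  simp only [of_apply, Matrix.smul_apply, smul_eq_mul, Real.one_rpow, one_mul, div_one]
  rw [inv_mul_cancel_left₀ hb0.ne']
  congr 1
  rw [hγ]
  ring

theorem sum_dotProduct_mulVec_eq {X : Type*} {n m : ℕ} (K : X → X → Matrix (Fin m) (Fin m) ℝ)
    (x : Fin n → X) (b : Fin n × Fin m → ℝ) :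
    ∑ p, ∑ q, (fun i => b (p, i)) ⬝ᵥ (K (x p) (x q)).mulVec (fun i => b (q, i)) =
      ∑ p, ∑ q, b p * b q * K (x p.1) (x q.1) p.2 q.2 := by
  simp only [Fintype.sum_prod_type, dotProduct, mulVec, Finset.mul_sum]
  refine Finset.sum_congr rfl fun p _ => ?_
  rw [Finset.sum_comm]
  refine Finset.sum_congr rfl fun i _ => Finset.sum_congr rfl fun q _ =>
    Finset.sum_congr rfl fun j _ => ?_
  ring

/-- Compactly supported non-stationary model. For a conditionally negative
definite kernel `Γ` with strictly positive entries, `s > 0` and `ν ≥ (d+1)/2`, the kernel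
with entries `C_ij(x,y) = s^{ν+1} B(γ_ij(x,y)+1, ν+1) max(1 − ‖x−y‖/s, 0)^{ν+γ_ij(x,y)+1}`
(`B(a,b) = Γ(a)Γ(b)/Γ(a+b)` the Beta function, `‖·‖` the Euclidean norm) is positive
definite and vanishes whenever `‖x−y‖ ≥ s`. -/
theorem compactly_supported_nonstationary_posdef {d m : ℕ}
    (Γ : EuclideanSpace ℝ (Fin d) → EuclideanSpace ℝ (Fin d) → Matrix (Fin m) (Fin m) ℝ)
    (hΓ : IsCondNegDefKernel Γ) (hpos : ∀ x y i j, 0 < Γ x y i j)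
    (s : ℝ) (hs : 0 < s) (ν : ℝ) (hν : ((d : ℝ) + 1) / 2 ≤ ν)
    (C : EuclideanSpace ℝ (Fin d) → EuclideanSpace ℝ (Fin d) → Matrix (Fin m) (Fin m) ℝ)
    (hC : ∀ x y i j, C x y i j =
      s ^ (ν + 1) *
        (Real.Gamma (Γ x y i j + 1) * Real.Gamma (ν + 1) /
          Real.Gamma (Γ x y i j + 1 + (ν + 1))) *
        max (1 - ‖x - y‖ / s) 0 ^ (ν + Γ x y i j + 1)) :
    IsPosDefKernel C ∧ ∀ x y i j, s ≤ ‖x - y‖ → C x y i j = 0 := by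
  have hν0 : 0 < ν := lt_of_lt_of_le (by positivity) hν
  refine ⟨⟨fun x y i j => ?_, fun n x a => ?_⟩, fun x y i j hxy => ?_⟩
  · rw [hC, hC, hΓ.1 x y i j, norm_sub_rev]
  · have hask (u : ℝ) (hu : 0 < u) := posSemidef_truncated_rpow_of_unit
      (posSemidef_askey hν) (fun p : Fin n × Fin m => x p.1) hu
    have hneg (b : Fin n × Fin m → ℝ) (hb : ∑ p, b p = 0) :
        ∑ p, ∑ q, b p * b q * Γ (x p.1) (x q.1) p.2 q.2 ≤ 0 := by
      rw [← sum_dotProduct_mulVec_eq Γ x b]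
      exact hΓ.2 n x (fun p i => b (p, i)) (by rw [← hb, Fintype.sum_prod_type])
    have h := posSemidef_beta_mul_truncated_rpow
      (D := fun p q : Fin n × Fin m => ‖x p.1 - x q.1‖)
      (G := fun p q : Fin n × Fin m => Γ (x p.1) (x q.1) p.2 q.2) hs hν0
      (fun _ _ => norm_nonneg _) hask (fun _ _ => neg_one_lt_zero.trans (hpos _ _ _ _))
      (fun _ _ => hΓ.1 _ _ _ _) hneg
    have h' := (posSemidef_real_iff.1 h).2 fun p => a p.1 p.2
    simp only [of_apply, ← hC] at h'
    rwa [← sum_dotProduct_mulVec_eq C x fun p => a p.1 p.2] at h'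
  · rw [hC, max_eq_right (sub_nonpos.2 ((one_le_div hs).2 hxy)),
      Real.zero_rpow (by linarith [hpos x y i j]), mul_zero]
end

section
/- Let Γ: ℝ^d × ℝ^d → ℝ^{m×m} be a conditionally negative definite matrix-valued kernel, let μ be a (nonnegative) measure on (0,∞), and let Σ_1,…,Σ_m: ℝ^d → ℝ^{d×d} be functions whose values are symmetric positive definite matrices; write Σ_{ij}(x,y) = (Σ_i(x) + Σ_j(y))/2 (a symmetric positive definite, hence invertible, matrix). Assume that for all x,y ∈ ℝ^d and i,j = 1,…,m the integral ∫_0^∞ exp(−t((x−y)ᵀ Σ_{ij}(x,y)^{−1} (x−y) + γ_ij(x,y))) dμ(t) is finite. Then the matrix-valued kernel C: ℝ^d × ℝ^d → ℝ^{m×m} with entries C_ij(x,y) = (det Σ_i(x))^{1/4} (det Σ_j(y))^{1/4} / (det Σ_{ij}(x,y))^{1/2} · ∫_0^∞ exp(−t((x−y)ᵀ Σ_{ij}(x,y)^{−1} (x−y) + γ_ij(x,y))) dμ(t), i,j = 1,…,m, is positive definite. -/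
open Matrix MeasureTheory Real Set
open scoped BigOperators

theorem posSemidef_iff_forall_sum_nonneg {κ : Type*} [Fintype κ] {M : Matrix κ κ ℝ} :
    M.PosSemidef ↔ (∀ k l, M k l = M l k) ∧ ∀ a : κ → ℝ, 0 ≤ ∑ k, ∑ l, a k * M k l * a l := by
  rw [Matrix.posSemidef_iff_dotProduct_mulVec]
  refine and_congr ?_ (forall_congr' fun a => ?_)
  · simp only [Matrix.IsHermitian, ← Matrix.ext_iff, Matrix.conjTranspose_apply, star_trivial]
    exact forall_comm
  · simp [dotProduct, Matrix.mulVec, Finset.mul_sum, mul_assoc]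

theorem Matrix.PosSemidef.map_pow {κ : Type*} [Fintype κ] {M : Matrix κ κ ℝ}
    (hM : M.PosSemidef) (N : ℕ) : (M.map (· ^ N)).PosSemidef := by
  induction N with
  | zero =>
    refine posSemidef_iff_forall_sum_nonneg.2 ⟨by simp, fun a => ?_⟩
    simpa [← Finset.sum_mul_sum] using mul_self_nonneg (∑ k, a k)
  | succ N ih =>
    have h := ih.hadamard hM
    have e : M.map (· ^ (N + 1)) = Matrix.hadamard (M.map (· ^ N)) M := by
      ext k l
      simp [pow_succ]
    rwa [e]

theorem Matrix.PosSemidef.map_exp {κ : Type*} [Fintype κ] {M : Matrix κ κ ℝ}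
    (hM : M.PosSemidef) : (M.map Real.exp).PosSemidef := by
  refine posSemidef_iff_forall_sum_nonneg.2 ⟨fun k l => ?_, fun a => ?_⟩
  · simp [(posSemidef_iff_forall_sum_nonneg.1 hM).1 k l]
  · have h : HasSum (fun N : ℕ => ∑ k, ∑ l, a k * ((N.factorial : ℝ)⁻¹ * M k l ^ N) * a l)
        (∑ k, ∑ l, a k * Real.exp (M k l) * a l) := by
      refine hasSum_sum fun k _ => hasSum_sum fun l _ => HasSum.mul_right _ (HasSum.mul_left _ ?_)
      simpa [Real.exp_eq_exp_ℝ] using NormedSpace.exp_series_hasSum_exp' (𝕂 := ℝ) (M k l)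
    refine h.nonneg fun N => ?_
    have h2 := (posSemidef_iff_forall_sum_nonneg.1 (hM.map_pow N)).2 a
    have e : ∑ k, ∑ l, a k * ((N.factorial : ℝ)⁻¹ * M k l ^ N) * a l =
        (N.factorial : ℝ)⁻¹ * ∑ k, ∑ l, a k * (M.map (· ^ N)) k l * a l := by
      simp only [Finset.mul_sum, Matrix.map_apply]
      exact Finset.sum_congr rfl fun k _ => Finset.sum_congr rfl fun l _ => by ring
    rw [e]
    positivity

/-- Scaling a positive semidefinite matrix by a rank-one matrix entrywise. -/
theorem Matrix.PosSemidef.mul_mul_entries {κ : Type*} [Fintype κ] {M : Matrix κ κ ℝ}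
    (hM : M.PosSemidef) (b : κ → ℝ) :
    (Matrix.of fun k l => b k * M k l * b l).PosSemidef := by
  rw [posSemidef_iff_forall_sum_nonneg] at hM ⊢
  refine ⟨fun k l => ?_, fun a => ?_⟩
  · simp only [Matrix.of_apply, hM.1 k l]
    ring
  · refine (hM.2 fun k => a k * b k).trans_eq ?_
    refine Finset.sum_congr rfl fun k _ => Finset.sum_congr rfl fun l _ => ?_
    simp only [Matrix.of_apply]
    ring

/-- Schoenberg's theorem for finite conditionally negative definite matrices. -/
theorem posSemidef_exp_neg_mul_of_condNegDef {κ : Type*} [Fintype κ] {G : Matrix κ κ ℝ}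
    (hsymm : ∀ k l, G k l = G l k)
    (hG : ∀ a : κ → ℝ, ∑ k, a k = 0 → ∑ k, ∑ l, a k * G k l * a l ≤ 0) {t : ℝ} (ht : 0 ≤ t) :
    (Matrix.of fun k l => Real.exp (-t * G k l)).PosSemidef := by
  classical
  rcases isEmpty_or_nonempty κ with hκ | ⟨⟨o⟩⟩
  · exact posSemidef_iff_forall_sum_nonneg.2 ⟨fun k => hκ.elim k, fun a => by simp⟩
  have hB : (Matrix.of fun k l => t * (G k o + G l o - G k l - G o o)).PosSemidef := by
    refine posSemidef_iff_forall_sum_nonneg.2 ⟨fun k l => ?_, fun a => ?_⟩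
    · simp only [Matrix.of_apply, hsymm k l]
      ring
    · set s := ∑ k, a k with hs
      have h := hG (fun k => a k - if k = o then s else 0) (by simp [hs])
      have e : ∑ k, ∑ l, (a k - if k = o then s else 0) * G k l * (a l - if l = o then s else 0)
          = ∑ k, ∑ l, a k * G k l * a l - s * ∑ k, a k * G k o - s * ∑ l, a l * G l o
            + s * s * G o o := by
        simp only [sub_mul, mul_sub, Finset.sum_sub_distrib, ite_mul, mul_ite, zero_mul, mul_zero,
          Finset.sum_ite_eq', Finset.mem_univ, if_true, Finset.mul_sum, Finset.sum_ite_irrel,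
          Finset.sum_const_zero, hsymm o]
        have e1 : ∑ x, a x * G x o * s = ∑ x, s * (a x * G x o) :=
          Finset.sum_congr rfl fun _ _ => by ring
        have e2 : ∑ x, s * G x o * a x = ∑ x, s * (a x * G x o) :=
          Finset.sum_congr rfl fun _ _ => by ring
        rw [e1, e2]
        ring
      have e' : ∑ k, ∑ l, a k * (t * (G k o + G l o - G k l - G o o)) * a l
          = -t * (∑ k, ∑ l, a k * G k l * a l - s * ∑ k, a k * G k o - s * ∑ l, a l * G l o
            + s * s * G o o) := by
        have e1 : s * ∑ k, a k * G k o = ∑ k, ∑ l, (a k * G k o) * a l := by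
          rw [← Finset.sum_mul_sum, mul_comm]
        have e2 : s * ∑ l, a l * G l o = ∑ k, ∑ l, a k * (a l * G l o) := by
          rw [← Finset.sum_mul_sum]
        have e3 : s * s * G o o = ∑ k, ∑ l, a k * a l * G o o := by
          rw [hs, Finset.sum_mul_sum, Finset.sum_mul]
          exact Finset.sum_congr rfl fun k _ => Finset.sum_mul _ _ _
        rw [e3]
        nth_rewrite 1 [e1]
        rw [e2, ← Finset.sum_sub_distrib, ← Finset.sum_sub_distrib, ← Finset.sum_add_distrib,
          Finset.mul_sum]
        refine Finset.sum_congr rfl fun k _ => ?_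
        rw [← Finset.sum_sub_distrib, ← Finset.sum_sub_distrib, ← Finset.sum_add_distrib,
          Finset.mul_sum]
        exact Finset.sum_congr rfl fun l _ => by ring
      simp only [Matrix.of_apply, e']
      rw [e] at h
      nlinarith
  have h := hB.map_exp.mul_mul_entries fun k => Real.exp (-t * (G k o - G o o / 2))
  convert h using 1
  ext k l
  simp only [Matrix.of_apply, Matrix.map_apply, ← Real.exp_add]
  congr 1
  ring

open scoped MatrixOrder Matrix.Norms.L2Operator in
theorem Matrix.PosSemidef.exists_eq_transpose_mul_self {ι : Type*} [Fintype ι] [DecidableEq ι]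
    {A : Matrix ι ι ℝ} (hA : A.PosSemidef) : ∃ B : Matrix ι ι ℝ, A = Bᵀ * B := by
  obtain ⟨B, hB⟩ := CStarAlgebra.nonneg_iff_eq_star_mul_self.mp hA.nonneg
  exact ⟨B, by simpa [Matrix.star_eq_conjTranspose] using hB⟩

theorem integral_comp_mulVec {ι : Type*} [Fintype ι] [DecidableEq ι] {B : Matrix ι ι ℝ}
    (hB : B.det ≠ 0) {f : (ι → ℝ) → ℂ} (hf : Continuous f) :
    ∫ v, f (B.mulVec v) = (|B.det|⁻¹ : ℝ) * ∫ v, f v := by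
  have h := integral_map (μ := volume) (φ := Matrix.toLin' B) (f := f)
    (LinearMap.continuous_of_finiteDimensional _).measurable.aemeasurable
    hf.aestronglyMeasurable
  rw [Real.map_matrix_volume_pi_eq_smul_volume_pi hB, integral_smul_measure,
    ENNReal.toReal_ofReal (abs_nonneg _)] at h
  simpa [abs_inv] using h.symm

/-- The Fourier transform of the Gaussian `exp (-vᵀ A v)`. -/
theorem integral_cexp_neg_quadForm_add {ι : Type*} [Fintype ι] [DecidableEq ι]
    {A : Matrix ι ι ℝ} (hA : A.PosDef) {t : ℝ} (ht : 0 ≤ t) (z : ι → ℝ) :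
    ∫ v : ι → ℝ, Complex.exp (-(v ⬝ᵥ A.mulVec v : ℝ) + Complex.I * (2 * √t * (z ⬝ᵥ v) : ℝ)) =
      (π ^ ((Fintype.card ι : ℝ) / 2) * (A.det ^ ((1 : ℝ) / 2))⁻¹ *
        Real.exp (-t * (z ⬝ᵥ A⁻¹.mulVec z)) : ℝ) := by
  obtain ⟨B, hAB⟩ := hA.posSemidef.exists_eq_transpose_mul_self
  have hdet : A.det = B.det ^ 2 := by simp [hAB, sq]
  have hB : B.det ≠ 0 := fun h => hA.det_pos.ne' (by simp [hdet, h])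
  have hBu : IsUnit B.det := hB.isUnit
  set w : ι → ℝ := (B⁻¹)ᵀ.mulVec z with hw
  have hz (v : ι → ℝ) : z ⬝ᵥ v = w ⬝ᵥ B.mulVec v := by
    rw [hw, Matrix.mulVec_transpose, ← Matrix.dotProduct_mulVec, Matrix.mulVec_mulVec,
      Matrix.nonsing_inv_mul _ hBu, Matrix.one_mulVec]
  have hq (v : ι → ℝ) : v ⬝ᵥ A.mulVec v = B.mulVec v ⬝ᵥ B.mulVec v := by
    rw [hAB, ← Matrix.mulVec_mulVec, Matrix.dotProduct_mulVec, Matrix.vecMul_transpose]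
  have hww : z ⬝ᵥ A⁻¹.mulVec z = w ⬝ᵥ w := by
    rw [hAB, Matrix.mul_inv_rev, ← Matrix.mulVec_mulVec, Matrix.dotProduct_mulVec,
      ← Matrix.transpose_nonsing_inv, ← Matrix.mulVec_transpose, hw]
  have key := integral_comp_mulVec hB (f := fun v : ι → ℝ =>
    Complex.exp (-(v ⬝ᵥ v : ℝ) + Complex.I * (2 * √t * (w ⬝ᵥ v) : ℝ))) (by
      simp only [dotProduct]; fun_prop)
  rw [hww]
  simp only [hz, hq]
  rw [key]
  have g := GaussianFourier.integral_cexp_neg_mul_sum_add (b := 1) (by simp)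
    (fun i : ι => Complex.I * (2 * √t * w i : ℝ))
  have e : ∀ v : ι → ℝ, Complex.exp (-(v ⬝ᵥ v : ℝ) + Complex.I * (2 * √t * (w ⬝ᵥ v) : ℝ)) =
      Complex.exp (-1 * ∑ i, (v i : ℂ) ^ 2 + ∑ i, Complex.I * (2 * √t * w i : ℝ) * v i) := by
    intro v
    congr 1
    simp only [dotProduct]
    push_cast
    simp only [Finset.mul_sum, ← Finset.sum_neg_distrib]
    congr 1
    · exact Finset.sum_congr rfl fun i _ => by ring
    · exact Finset.sum_congr rfl fun i _ => by ring
  simp only [e]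
  rw [g, hdet]
  have hsqrt : (B.det ^ 2) ^ ((1 : ℝ) / 2) = |B.det| := by
    rw [← Real.sqrt_eq_rpow, Real.sqrt_sq_eq_abs]
  have hsum : (∑ i, (Complex.I * (2 * √t * w i : ℝ)) ^ 2) / (4 * 1) = (-t * (w ⬝ᵥ w) : ℝ) := by
    have ht' : ((√t : ℝ) : ℂ) ^ 2 = t := by rw [← Complex.ofReal_pow, Real.sq_sqrt ht]
    simp only [dotProduct]
    push_cast
    rw [Finset.mul_sum, Finset.sum_div]
    refine Finset.sum_congr rfl fun i _ => ?_
    simp only [mul_pow, Complex.I_sq, ht']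
    ring
  rw [hsum, hsqrt]
  push_cast
  rw [Complex.ofReal_cpow Real.pi_pos.le]
  push_cast
  rw [div_one]
  ring

theorem integrable_cexp_neg_quadForm_add {ι : Type*} [Fintype ι] [DecidableEq ι]
    {A : Matrix ι ι ℝ} (hA : A.PosDef) {t : ℝ} (ht : 0 ≤ t) (z : ι → ℝ) :
    Integrable fun v : ι → ℝ =>
      Complex.exp (-(v ⬝ᵥ A.mulVec v : ℝ) + Complex.I * (2 * √t * (z ⬝ᵥ v) : ℝ)) := by
  by_contra h
  have e := integral_cexp_neg_quadForm_add hA ht z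
  rw [integral_undef h] at e
  have hpos : 0 < π ^ ((Fintype.card ι : ℝ) / 2) * (A.det ^ ((1 : ℝ) / 2))⁻¹ *
      Real.exp (-t * (z ⬝ᵥ A⁻¹.mulVec z)) := by
    have := hA.det_pos
    positivity
  exact hpos.ne (by exact_mod_cast e)

theorem Matrix.PosDef.half_smul_add {ι : Type*} [Fintype ι] {A B : Matrix ι ι ℝ}
    (hA : A.PosDef) (hB : B.PosDef) : (((1 : ℝ) / 2) • (A + B)).PosDef :=
  (hA.add hB).smul (by norm_num)

/-- The non-stationary Gaussian kernel of Paciorek and Schervish, restricted to finitely many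
points, without its determinantal normalisation. -/
theorem posSemidef_nonstationary_gaussian {κ ι : Type*} [Fintype κ] [Fintype ι] [DecidableEq ι]
    {A : κ → Matrix ι ι ℝ} (hA : ∀ k, (A k).PosDef) (x : κ → ι → ℝ) {t : ℝ} (ht : 0 ≤ t) :
    (Matrix.of fun k l => ((((1 : ℝ) / 2) • (A k + A l)).det ^ ((1 : ℝ) / 2))⁻¹ *
      Real.exp (-t * ((x k - x l) ⬝ᵥ
        ((((1 : ℝ) / 2) • (A k + A l))⁻¹).mulVec (x k - x l)))).PosSemidef := by
  refine posSemidef_iff_forall_sum_nonneg.2 ⟨fun k l => ?_, fun a => ?_⟩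
  · simp only [Matrix.of_apply]
    rw [add_comm (A k), ← neg_sub (x l)]
    simp only [Matrix.mulVec_neg, neg_dotProduct_neg]
  set φ : κ → (ι → ℝ) → ℂ := fun k v =>
    Complex.exp (-(v ⬝ᵥ (A k).mulVec v / 2 : ℝ) + Complex.I * (2 * √t * (x k ⬝ᵥ v) : ℝ)) with hφ
  set F : κ → κ → (ι → ℝ) → ℂ := fun k l v =>
    Complex.exp (-(v ⬝ᵥ (((1 : ℝ) / 2) • (A k + A l)).mulVec v : ℝ) +
      Complex.I * (2 * √t * ((x k - x l) ⬝ᵥ v) : ℝ)) with hF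
  have hmul (k l : κ) (v : ι → ℝ) : φ k v * (starRingEnd ℂ) (φ l v) = F k l v := by
    simp only [hφ, hF, ← Complex.exp_conj, ← Complex.exp_add, map_add, map_neg, map_mul,
      Complex.conj_ofReal, Complex.conj_I, Matrix.smul_mulVec, Matrix.add_mulVec, dotProduct_smul,
      dotProduct_add, sub_dotProduct, smul_eq_mul]
    congr 1
    push_cast
    ring
  have hsq (v : ι → ℝ) : ∑ k, ∑ l, (a k * a l : ℂ) * F k l v =
      (Complex.normSq (∑ k, a k * φ k v) : ℝ) := by
    rw [← Complex.mul_conj, map_sum, Finset.sum_mul_sum]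
    refine Finset.sum_congr rfl fun k _ => Finset.sum_congr rfl fun l _ => ?_
    rw [← hmul, map_mul, Complex.conj_ofReal]
    ring
  have hI (k l : κ) : Integrable (F k l) :=
    integrable_cexp_neg_quadForm_add ((hA k).half_smul_add (hA l)) ht _
  have hint : ∫ v, ∑ k, ∑ l, (a k * a l : ℂ) * F k l v =
      ∑ k, ∑ l, (a k * a l : ℂ) * ∫ v, F k l v := by
    rw [integral_finsetSum _ fun k _ => integrable_finsetSum _ fun l _ => (hI k l).const_mul _]
    refine Finset.sum_congr rfl fun k _ => ?_
    rw [integral_finsetSum _ fun l _ => (hI k l).const_mul _]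
    exact Finset.sum_congr rfl fun l _ => integral_const_mul _ _
  simp only [hsq, integral_complex_ofReal] at hint
  have hFint (k l : κ) : ∫ v, F k l v = (_ : ℝ) :=
    integral_cexp_neg_quadForm_add ((hA k).half_smul_add (hA l)) ht (x k - x l)
  simp only [hFint] at hint
  norm_cast at hint
  have hnn : 0 ≤ ∫ v : ι → ℝ, Complex.normSq (∑ k, a k * φ k v) :=
    integral_nonneg fun v => Complex.normSq_nonneg _
  rw [hint] at hnn
  have hπ : 0 < π ^ ((Fintype.card ι : ℝ) / 2) := by positivity
  refine nonneg_of_mul_nonneg_right (hnn.trans_eq ?_) hπ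
  simp only [Finset.mul_sum, Matrix.of_apply]
  exact Finset.sum_congr rfl fun k _ => Finset.sum_congr rfl fun l _ => by ring

theorem sum_dotProduct_mulVec_eq_sum_prod {X : Type*} {n m : ℕ}
    (K : X → X → Matrix (Fin m) (Fin m) ℝ) (x : Fin n → X) (a : Fin n → Fin m → ℝ) :
    ∑ p, ∑ q, a p ⬝ᵥ (K (x p) (x q)).mulVec (a q) =
      ∑ k : Fin n × Fin m, ∑ l : Fin n × Fin m,
        a k.1 k.2 * K (x k.1) (x l.1) k.2 l.2 * a l.1 l.2 := by
  simp only [Fintype.sum_prod_type, dotProduct, Matrix.mulVec, Finset.mul_sum, mul_assoc]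
  exact Finset.sum_congr rfl fun p _ => Finset.sum_comm

theorem isPosDefKernel_iff {X : Type*} {m : ℕ} {K : X → X → Matrix (Fin m) (Fin m) ℝ} :
    IsPosDefKernel K ↔ (∀ x y i j, K x y i j = K y x j i) ∧
      ∀ (n : ℕ) (x : Fin n → X) (a : Fin n → Fin m → ℝ),
        0 ≤ ∑ k : Fin n × Fin m, ∑ l : Fin n × Fin m,
          a k.1 k.2 * K (x k.1) (x l.1) k.2 l.2 * a l.1 l.2 := by
  simp only [IsPosDefKernel, sum_dotProduct_mulVec_eq_sum_prod]

/-- Non-stationary Paciorek/Kleiber–Nychka-type construction. For a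
conditionally negative definite kernel `Γ`, a measure `μ` on `(0,∞)`, and fields of
symmetric positive definite matrices `Σ_i(x)` with `Σ_ij(x,y) = (Σ_i(x) + Σ_j(y))/2`, the
kernel with entries
`C_ij(x,y) = det(Σ_i(x))^{1/4} det(Σ_j(y))^{1/4} / det(Σ_ij(x,y))^{1/2} ·
∫_0^∞ exp(−t((x−y)ᵀ Σ_ij(x,y)⁻¹ (x−y) + γ_ij(x,y))) dμ(t)` is positive definite, provided
the integrals are finite. -/
theorem paciorek_construction_posdef {d m : ℕ}
    (Γ : (Fin d → ℝ) → (Fin d → ℝ) → Matrix (Fin m) (Fin m) ℝ)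
    (hΓ : IsCondNegDefKernel Γ)
    (μ : Measure ℝ)
    (S : Fin m → (Fin d → ℝ) → Matrix (Fin d) (Fin d) ℝ)
    (hS : ∀ i x, (S i x).PosDef)
    (hint : ∀ x y i j, IntegrableOn (fun t : ℝ =>
      Real.exp (-t * ((x - y) ⬝ᵥ ((((1:ℝ)/2) • (S i x + S j y))⁻¹).mulVec (x - y)
        + Γ x y i j))) (Ioi 0) μ) :
    IsPosDefKernel (fun x y => Matrix.of fun i j =>
      (S i x).det ^ ((1:ℝ)/4) * (S j y).det ^ ((1:ℝ)/4) /
        (((1:ℝ)/2) • (S i x + S j y)).det ^ ((1:ℝ)/2) *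
      ∫ t in Ioi (0:ℝ),
        Real.exp (-t * ((x - y) ⬝ᵥ ((((1:ℝ)/2) • (S i x + S j y))⁻¹).mulVec (x - y)
          + Γ x y i j)) ∂μ) := by
  refine isPosDefKernel_iff.2 ⟨fun x y i j => ?_, fun n x a => ?_⟩
  · simp only [Matrix.of_apply]
    rw [add_comm (S i x), ← neg_sub y x, hΓ.1 x y]
    simp only [Matrix.mulVec_neg, neg_dotProduct_neg]
    ring
  · set A : Fin n × Fin m → Matrix (Fin d) (Fin d) ℝ := fun k => S k.2 (x k.1) with hA
    set G : Matrix (Fin n × Fin m) (Fin n × Fin m) ℝ :=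
      Matrix.of fun k l => Γ (x k.1) (x l.1) k.2 l.2 with hG
    set b : Fin n × Fin m → ℝ := fun k => a k.1 k.2 * (A k).det ^ ((1 : ℝ) / 4) with hb
    set E : Fin n × Fin m → Fin n × Fin m → ℝ → ℝ := fun k l t =>
      Real.exp (-t * ((x k.1 - x l.1) ⬝ᵥ
        ((((1 : ℝ) / 2) • (A k + A l))⁻¹).mulVec (x k.1 - x l.1) + G k l)) with hE
    have hEint (k l) : IntegrableOn (E k l) (Ioi 0) μ :=
      hint (x k.1) (x l.1) k.2 l.2
    have hGsymm (k l) : G k l = G l k := hΓ.1 _ _ _ _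
    have hGneg (c : Fin n × Fin m → ℝ) (hc : ∑ k, c k = 0) :
        ∑ k, ∑ l, c k * G k l * c l ≤ 0 := by
      have h := hΓ.2 n x (fun p i => c (p, i)) (by rwa [Fintype.sum_prod_type] at hc)
      rwa [sum_dotProduct_mulVec_eq_sum_prod] at h
    calc (0 : ℝ) ≤ ∫ t in Ioi (0 : ℝ), ∑ k, ∑ l,
          b k * b l * ((((1 : ℝ) / 2) • (A k + A l)).det ^ ((1 : ℝ) / 2))⁻¹ * E k l t ∂μ := by
          refine setIntegral_nonneg measurableSet_Ioi fun t (ht : 0 < t) => ?_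
          have h := (posSemidef_iff_forall_sum_nonneg.1
            ((posSemidef_nonstationary_gaussian (fun k => hS k.2 (x k.1)) (fun k => x k.1)
              ht.le).hadamard (posSemidef_exp_neg_mul_of_condNegDef hGsymm hGneg ht.le))).2 b
          refine h.trans_eq (Finset.sum_congr rfl fun k _ => Finset.sum_congr rfl fun l _ => ?_)
          simp only [Matrix.hadamard_apply, Matrix.of_apply, hE, mul_add, Real.exp_add, hA]
          ring
      _ = ∑ k, ∑ l, b k * b l * ((((1 : ℝ) / 2) • (A k + A l)).det ^ ((1 : ℝ) / 2))⁻¹ *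
            ∫ t in Ioi (0 : ℝ), E k l t ∂μ := by
          rw [integral_finsetSum _ fun k _ =>
            integrable_finsetSum _ fun l _ => (hEint k l).const_mul _]
          refine Finset.sum_congr rfl fun k _ => ?_
          rw [integral_finsetSum _ fun l _ => (hEint k l).const_mul _]
          exact Finset.sum_congr rfl fun l _ => integral_const_mul _ _
      _ = _ := by
          refine Finset.sum_congr rfl fun k _ => Finset.sum_congr rfl fun l _ => ?_
          simp only [Matrix.of_apply, hb, hE, hA, hG]
          ring
end

section
/- Let γ: ℝ^d → ℝ^{m×m} be a pseudo cross-variogram whose component functions γ_ij are twice continuously differentiable. Then for each k = 1,…,d, the matrix-valued function C: ℝ^d → ℝ^{m×m} with entries C_ij(h) = ∂²γ_ij(h)/∂h_k² (the second partial derivative in the k-th coordinate direction), i,j = 1,…,m, is positive definite. -/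
open Matrix MeasureTheory Real Set
open scoped BigOperators

/-- The second derivative of a `C²` function is nonnegative at a point where all symmetric
second differences are nonnegative. -/
theorem iteratedDeriv_two_nonneg_of_second_difference_nonneg {f : ℝ → ℝ} (hf : ContDiff ℝ 2 f)
    {c : ℝ} (h : ∀ t, 0 ≤ f (c + t) + f (c - t) - 2 * f c) : 0 ≤ iteratedDeriv 2 f c := by
  set φ : ℝ → ℝ := fun t => f (c + t) + f (c - t) with hφ
  have hφ2 : iteratedDeriv 2 φ 0 = 2 * iteratedDeriv 2 f c := by
    rw [hφ, iteratedDeriv_fun_add (by fun_prop) (by fun_prop), iteratedDeriv_comp_const_add,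
      iteratedDeriv_comp_const_sub]
    simp
    ring
  have hφc : ContinuousAt φ 0 :=
    ((hf.continuous.comp (by fun_prop)).add (hf.continuous.comp (by fun_prop))).continuousAt
  have hmin : ∀ t, φ 0 ≤ φ t := fun t => by
    have := h t
    simp only [hφ, add_zero, sub_zero]
    linarith
  have hd : deriv φ 0 = 0 := IsLocalMin.deriv_eq_zero (.of_forall hmin)
  by_contra! hneg
  rw [iteratedDeriv_succ, iteratedDeriv_one] at hφ2
  have hmax : IsLocalMax φ 0 := isLocalMax_of_deriv_deriv_neg (by linarith) hd
    hφc
  have hconst : φ =ᶠ[nhds 0] fun _ => φ 0 := hmax.mono fun t ht => le_antisymm ht (hmin t)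
  have : deriv (deriv φ) 0 = 0 := by simpa using hconst.deriv.deriv_eq
  linarith

/-- Symmetric second differences of a conditionally negative definite function are
nonnegative in the sense of quadratic forms. -/
theorem IsCondNegDefKernel.second_difference_nonneg {V : Type*} [AddCommGroup V] {m : ℕ}
    {γ : V → Matrix (Fin m) (Fin m) ℝ} (hγ : IsCondNegDefKernel fun x y => γ (x - y))
    {n : ℕ} (x : Fin n → V) (a : Fin n → Fin m → ℝ) (s : V) :
    0 ≤ (∑ p, ∑ q, a p ⬝ᵥ (γ (x p - x q + s)).mulVec (a q)) +
      (∑ p, ∑ q, a p ⬝ᵥ (γ (x p - x q - s)).mulVec (a q)) -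
      2 * ∑ p, ∑ q, a p ⬝ᵥ (γ (x p - x q)).mulVec (a q) := by
  have key := hγ.2 (n + n) (Fin.append (fun p => x p + s) x) (Fin.append a (-a))
    (by
      simp only [Fin.sum_univ_add, Fin.append_left, Fin.append_right, Pi.neg_apply,
        Finset.sum_neg_distrib, add_neg_cancel])
  have h₁ (p q : Fin n) : x p + s - x q = x p - x q + s := by abel
  have h₂ (p q : Fin n) : x p - (x q + s) = x p - x q - s := by abel
  simp only [Fin.sum_univ_add, Fin.append_left, Fin.append_right, Pi.neg_apply, neg_dotProduct,
    Matrix.mulVec_neg, dotProduct_neg, Finset.sum_add_distrib, Finset.sum_neg_distrib,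
    add_sub_add_right_eq_sub, h₁, h₂] at key
  linarith

/-- For a pseudo cross-variogram `γ` with twice continuously differentiable
components, the matrix-valued function with entries `C_ij(h) = ∂²γ_ij(h)/∂h_k²` is positive
definite for each coordinate direction `k`. -/
theorem second_partial_deriv_posdef {d m : ℕ}
    (γ : (Fin d → ℝ) → Matrix (Fin m) (Fin m) ℝ)
    (hγ : IsPseudoCrossVariogram γ)
    (hC2 : ∀ i j, ContDiff ℝ 2 fun h => γ h i j)
    (k : Fin d) :
    IsPosDefFun (fun h => Matrix.of fun i j =>
      iteratedDeriv 2 (fun t : ℝ => γ (Function.update h k t) i j) (h k)) := by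
  refine ⟨fun x y i j => ?_, fun n x a => ?_⟩
  · have hsymm : (fun t : ℝ => γ (Function.update (x - y) k t) i j) =
        fun t => γ (Function.update (y - x) k (-t)) j i := by
      funext t
      have := hγ.1.1 (Function.update (x - y) k t) 0 i j
      beta_reduce at this
      rw [sub_zero, zero_sub, ← Function.update_neg, neg_sub] at this
      exact this
    simp only [Matrix.of_apply]
    rw [hsymm, iteratedDeriv_comp_neg 2 (fun t => γ (Function.update (y - x) k t) j i)]
    simp
  · have hsmooth (h : Fin d → ℝ) (i j : Fin m) :
        ContDiff ℝ 2 fun t : ℝ => γ (h + Pi.single k t) i j :=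
      (hC2 i j).comp (contDiff_const.add (ContinuousLinearMap.single ℝ (fun _ => ℝ) k).contDiff)
    have hderiv (h : Fin d → ℝ) (i j : Fin m) :
        iteratedDeriv 2 (fun t : ℝ => γ (Function.update h k t) i j) (h k) =
          iteratedDeriv 2 (fun t : ℝ => γ (h + Pi.single k t) i j) 0 := by
      have hupd : (fun t : ℝ => γ (h + Pi.single k t) i j) =
          fun t => γ (Function.update h k (h k + t)) i j := by
        funext t
        congr 2
        ext l
        rcases eq_or_ne l k with rfl | hl <;> simp [*]
      rw [hupd, iteratedDeriv_comp_const_add 2 (fun t => γ (Function.update h k t) i j)]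
      simp
    set F : ℝ → ℝ := fun t =>
      ∑ p, ∑ q, a p ⬝ᵥ (γ (x p - x q + Pi.single k t)).mulVec (a q) with hF
    have hF_eq : F = fun t => ∑ p, ∑ q, ∑ i, ∑ j,
        a p i * a q j * γ (x p - x q + Pi.single k t) i j := by
      funext t
      simp only [hF, dotProduct, Matrix.mulVec, Finset.mul_sum]
      refine Finset.sum_congr rfl fun p _ => Finset.sum_congr rfl fun q _ =>
        Finset.sum_congr rfl fun i _ => Finset.sum_congr rfl fun j _ => by ring
    have hterm (p q i j) : ContDiff ℝ 2 fun t =>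
        a p i * a q j * γ (x p - x q + Pi.single k t) i j :=
      contDiff_const.mul (hsmooth _ i j)
    have hsum_j (p q i) : ContDiff ℝ 2 fun t =>
        ∑ j, a p i * a q j * γ (x p - x q + Pi.single k t) i j :=
      ContDiff.sum fun j _ => hterm p q i j
    have hsum_ij (p q) : ContDiff ℝ 2 fun t =>
        ∑ i, ∑ j, a p i * a q j * γ (x p - x q + Pi.single k t) i j :=
      ContDiff.sum fun i _ => hsum_j p q i
    have hsum_qij (p) : ContDiff ℝ 2 fun t =>
        ∑ q, ∑ i, ∑ j, a p i * a q j * γ (x p - x q + Pi.single k t) i j :=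
      ContDiff.sum fun q _ => hsum_ij p q
    have hF_smooth : ContDiff ℝ 2 F := by
      rw [hF_eq]
      exact ContDiff.sum fun p _ => hsum_qij p
    have hF_deriv : iteratedDeriv 2 F 0 = ∑ p, ∑ q, ∑ i, ∑ j,
        a p i * a q j * iteratedDeriv 2 (fun t => γ (x p - x q + Pi.single k t) i j) 0 := by
      rw [hF_eq, iteratedDeriv_fun_sum fun p _ => (hsum_qij p).contDiffAt]
      refine Finset.sum_congr rfl fun p _ => ?_
      rw [iteratedDeriv_fun_sum fun q _ => (hsum_ij p q).contDiffAt]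
      refine Finset.sum_congr rfl fun q _ => ?_
      rw [iteratedDeriv_fun_sum fun i _ => (hsum_j p q i).contDiffAt]
      refine Finset.sum_congr rfl fun i _ => ?_
      rw [iteratedDeriv_fun_sum fun j _ => (hterm p q i j).contDiffAt]
      exact Finset.sum_congr rfl fun j _ => iteratedDeriv_const_mul_field _ _
    have hnonneg : 0 ≤ iteratedDeriv 2 F 0 := by
      refine iteratedDeriv_two_nonneg_of_second_difference_nonneg hF_smooth fun t => ?_
      simpa [hF, Pi.single_neg, ← sub_eq_add_neg] using
        hγ.1.second_difference_nonneg x a (Pi.single k t)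
    rw [hF_deriv] at hnonneg
    refine hnonneg.trans_eq ?_
    simp only [dotProduct, Matrix.mulVec, Finset.mul_sum, Matrix.of_apply, hderiv]
    refine Finset.sum_congr rfl fun p _ => Finset.sum_congr rfl fun q _ =>
      Finset.sum_congr rfl fun i _ => Finset.sum_congr rfl fun j _ => by ring
end

section
/- Let L: [0,∞) → ℝ be the continuous extension of a completely monotone function, i.e., L is continuous on [0,∞), infinitely differentiable on (0,∞) with (−1)^n L^{(n)}(x) ≥ 0 for all x > 0 and n ≥ 0, and assume additionally that L′ extends continuously to [0,∞). Let γ: ℝ^d × ℝ → ℝ^{m×m} be a pseudo cross-variogram (of a spatio-temporal random field) whose component functions γ_ij are twice continuously differentiable. Then the matrix-valued function C: ℝ^d × ℝ → ℝ^{m×m} with entries C_ij(h,u) = L(γ_ij(h,u)) · ∂²γ_ij(h,u)/∂u² + L′(γ_ij(h,u)) · (∂γ_ij(h,u)/∂u)², i,j = 1,…,m, is positive definite. -/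
open Matrix MeasureTheory Real Set
open scoped BigOperators

/-- The remainder after `n` terms of the Taylor expansion at `0` of `h k`, where `h (k + 1)` is
the derivative of `h k`. -/
noncomputable def taylorRemainder (h : ℕ → ℝ → ℝ) (n k : ℕ) (y : ℝ) : ℝ :=
  h k y - ∑ j ∈ Finset.range n, h (k + j) 0 / (j.factorial : ℝ) * y ^ j

lemma taylorRemainder_hasDerivAt {h : ℕ → ℝ → ℝ} {n k : ℕ} {y : ℝ}
    (hd : HasDerivAt (h k) (h (k + 1) y) y) :
    HasDerivAt (taylorRemainder h (n + 1) k) (taylorRemainder h n (k + 1) y) y := by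
  unfold taylorRemainder
  refine hd.sub ?_
  have : ∀ j ∈ Finset.range (n + 1), HasDerivAt
      (fun y : ℝ => h (k + j) 0 / (j.factorial : ℝ) * y ^ j)
      (h (k + j) 0 / (j.factorial : ℝ) * (j * y ^ (j - 1))) y := fun j _ =>
    (hasDerivAt_pow j y).const_mul _
  convert HasDerivAt.fun_sum this using 1
  rw [Finset.sum_range_succ']
  simp only [Nat.cast_zero, zero_mul, mul_zero, add_zero]
  refine Finset.sum_congr rfl fun j _ => ?_
  rw [Nat.factorial_succ, Nat.add_sub_cancel, show k + 1 + j = k + (j + 1) by ring]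
  have : (j.factorial : ℝ) ≠ 0 := by positivity
  push_cast
  field_simp

lemma taylorRemainder_zero_right (h : ℕ → ℝ → ℝ) (n k : ℕ) :
    taylorRemainder h (n + 1) k 0 = 0 := by
  simp [taylorRemainder, Finset.sum_range_succ']

lemma le_of_hasDerivAt_nonneg {f f' : ℝ → ℝ} {r : ℝ} (hr : 0 ≤ r)
    (hf : ∀ t ∈ Icc 0 r, HasDerivAt f (f' t) t) (hf' : ∀ t ∈ Icc 0 r, 0 ≤ f' t) : f 0 ≤ f r := by
  refine monotoneOn_of_hasDerivWithinAt_nonneg (convex_Icc 0 r)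
    (fun t ht => (hf t ht).continuousAt.continuousWithinAt)
    (fun t ht => (hf t (interior_subset ht)).hasDerivWithinAt)
    (fun t ht => hf' t (interior_subset ht)) (left_mem_Icc.2 hr) (right_mem_Icc.2 hr) hr

section AbsolutelyMonotone

variable {h : ℕ → ℝ → ℝ} {R : ℝ}

lemma taylorRemainder_nonneg (hd : ∀ n, ∀ t < R, HasDerivAt (h n) (h (n + 1) t) t)
    (hpos : ∀ n, ∀ t < R, 0 ≤ h n t) (n k : ℕ) {t : ℝ} (ht : 0 ≤ t) (htR : t < R) :
    0 ≤ taylorRemainder h n k t := by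
  induction n generalizing k t with
  | zero => simpa [taylorRemainder] using hpos k t htR
  | succ n ih =>
    rw [← taylorRemainder_zero_right h n k]
    exact le_of_hasDerivAt_nonneg ht
      (fun s hs => taylorRemainder_hasDerivAt (hd k s (hs.2.trans_lt htR)))
      (fun s hs => ih (k + 1) hs.1 (hs.2.trans_lt htR))

lemma taylorRemainder_mul_le (hd : ∀ n, ∀ t < R, HasDerivAt (h n) (h (n + 1) t) t)
    (hpos : ∀ n, ∀ t < R, 0 ≤ h n t) {c : ℝ} (hc : 0 ≤ c) (hc1 : c ≤ 1)
    (n k : ℕ) {t : ℝ} (ht : 0 ≤ t) (htR : t < R) :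
    taylorRemainder h n k (c * t) ≤ c ^ n * taylorRemainder h n k t := by
  induction n generalizing k t with
  | zero =>
    have hct : c * t ≤ t := mul_le_of_le_one_left ht hc1
    have : h k (c * t) ≤ h k t := by
      have hmono := monotoneOn_of_hasDerivWithinAt_nonneg (convex_Icc 0 t)
        (fun s hs => (hd k s (hs.2.trans_lt htR)).continuousAt.continuousWithinAt)
        (fun s hs => (hd k s ((interior_subset hs).2.trans_lt htR)).hasDerivWithinAt)
        (fun s hs => hpos (k + 1) s ((interior_subset hs).2.trans_lt htR))
      exact hmono ⟨by positivity, hct⟩ (right_mem_Icc.2 ht) hct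
    simpa [taylorRemainder] using this
  | succ n ih =>
    rw [← sub_nonneg]
    have hlt : ∀ s ∈ Icc 0 t, s < R ∧ c * s < R := fun s hs =>
      ⟨hs.2.trans_lt htR, (mul_le_of_le_one_left hs.1 hc1).trans_lt (hs.2.trans_lt htR)⟩
    have key := le_of_hasDerivAt_nonneg (r := t) ht
      (f := fun s => c ^ (n + 1) * taylorRemainder h (n + 1) k s
        - taylorRemainder h (n + 1) k (c * s))
      (f' := fun s => c ^ (n + 1) * taylorRemainder h n (k + 1) s
        - taylorRemainder h n (k + 1) (c * s) * c)
      (fun s hs => by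
        refine ((taylorRemainder_hasDerivAt (hd k s (hlt s hs).1)).const_mul _).sub ?_
        have h1 : HasDerivAt (fun s : ℝ => c * s) c s := by
          simpa using (hasDerivAt_id s).const_mul c
        exact (taylorRemainder_hasDerivAt (hd k (c * s) (hlt s hs).2)).comp s h1)
      (fun s hs => by
        have := mul_le_mul_of_nonneg_right (ih (k + 1) hs.1 (hlt s hs).1) hc
        rw [pow_succ]
        linarith)
    simpa [taylorRemainder_zero_right] using key

/-- Bernstein's theorem on the power series expansion of absolutely monotone functions. -/
lemma hasSum_taylor_of_nonneg (hd : ∀ n, ∀ t < R, HasDerivAt (h n) (h (n + 1) t) t)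
    (hpos : ∀ n, ∀ t < R, 0 ≤ h n t) (k : ℕ) {y : ℝ} (hy : 0 ≤ y) (hyR : y < R) :
    HasSum (fun j => h (k + j) 0 / (j.factorial : ℝ) * y ^ j) (h k y) := by
  have hR : 0 < R := hy.trans_lt hyR
  have hterm : ∀ j, ∀ r, 0 ≤ r → 0 ≤ h (k + j) 0 / (j.factorial : ℝ) * r ^ j := fun j r hr =>
    mul_nonneg (div_nonneg (hpos _ 0 hR) (by positivity)) (pow_nonneg hr j)
  rw [hasSum_iff_tendsto_nat_of_nonneg (fun j => hterm j y hy)]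
  obtain ⟨r, hyr, hrR⟩ := exists_between hyR
  have hr : 0 < r := hy.trans_lt hyr
  set c := y / r
  have hc : 0 ≤ c := by positivity
  have hc1 : c < 1 := (div_lt_one hr).2 hyr
  have hcr : c * r = y := div_mul_cancel₀ y hr.ne'
  have hlim : Filter.Tendsto (fun n => taylorRemainder h n k y) Filter.atTop (nhds 0) := by
    have h0 : Filter.Tendsto (fun n : ℕ => c ^ n * h k r) Filter.atTop (nhds 0) := by
      simpa using (tendsto_pow_atTop_nhds_zero_of_lt_one hc hc1).mul_const (h k r)
    refine squeeze_zero (fun n => taylorRemainder_nonneg hd hpos n k hy hyR) (fun n => ?_) h0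
    rw [← hcr]
    refine (taylorRemainder_mul_le hd hpos hc hc1.le n k hr.le hrR).trans ?_
    refine mul_le_mul_of_nonneg_left ?_ (pow_nonneg hc n)
    have := Finset.sum_nonneg fun j (_ : j ∈ Finset.range n) => hterm j r hr.le
    unfold taylorRemainder
    linarith
  have := (tendsto_const_nhds (x := h k y)).sub hlim
  simpa [taylorRemainder] using this

end AbsolutelyMonotone

lemma hasDerivAt_iteratedDeriv_of_contDiffOn {L : ℝ → ℝ}
    (hL : ContDiffOn ℝ (⊤ : ℕ∞) L (Ioi 0)) (n : ℕ) {x : ℝ} (hx : 0 < x) :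
    HasDerivAt (iteratedDeriv n L) (iteratedDeriv (n + 1) L x) x := by
  rw [iteratedDeriv_succ]
  refine DifferentiableAt.hasDerivAt ?_
  have h := (hL.contDiffAt (Ioi_mem_nhds hx))
  have h1 : ContDiffWithinAt ℝ (⊤ : ℕ∞) L (insert x univ) x := by
    simpa using h.contDiffWithinAt (s := univ)
  have := h1.differentiableWithinAt_iteratedDerivWithin (m := n)
    (by exact_mod_cast ENat.natCast_lt_top n) (by simp)
  simpa [iteratedDerivWithin_univ, differentiableWithinAt_univ] using this

lemma tendsto_one_sub_exp_div (x : ℝ) :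
    Filter.Tendsto (fun δ : ℝ => 1 / δ + δ - exp (-(δ * x)) / δ) (nhdsWithin 0 (Ioi 0))
      (nhds x) := by
  have h1 : HasDerivAt (fun δ : ℝ => exp (-(δ * x))) (-x) 0 := by
    have : HasDerivAt (fun δ : ℝ => -(δ * x)) (-x) 0 := by
      simpa using! ((hasDerivAt_id (0 : ℝ)).mul_const x).neg
    simpa using this.exp
  have h2 := (hasDerivAt_iff_tendsto_slope_zero.1 h1).mono_left
    (nhdsWithin_mono 0 (fun t (ht : t ∈ Ioi (0 : ℝ)) => ne_of_gt ht))
  have h3 : Filter.Tendsto (fun δ : ℝ => δ) (nhdsWithin 0 (Ioi 0)) (nhds 0) :=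
    nhdsWithin_le_nhds
  have h4 := h3.sub h2
  rw [zero_sub, neg_neg] at h4
  refine h4.congr fun δ => ?_
  simp
  ring

/-- If `∑ e^{-s X} (Y - s Z) ≥ 0` for all `s ≥ 0`, then `∑ (L(X) Y + L'(X) Z) ≥ 0` for every
completely monotone function `L`. -/
lemma sum_completelyMonotone_nonneg {L L' : ℝ → ℝ} (hLc : ContinuousOn L (Ici 0))
    (hLsm : ContDiffOn ℝ (⊤ : ℕ∞) L (Ioi 0))
    (hcm : ∀ (n : ℕ) (x : ℝ), 0 < x → 0 ≤ (-1 : ℝ) ^ n * iteratedDeriv n L x)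
    (hL'c : ContinuousOn L' (Ici 0)) (hL'eq : ∀ x : ℝ, 0 < x → L' x = deriv L x)
    {κ : Type*} [Fintype κ] (X Y Z : κ → ℝ) (hX : ∀ k, 0 ≤ X k)
    (H : ∀ s : ℝ, 0 ≤ s → 0 ≤ ∑ k, exp (-(s * X k)) * (Y k - s * Z k)) :
    0 ≤ ∑ k, (L (X k) * Y k + L' (X k) * Z k) := by
  set w : ℝ → κ → ℝ := fun δ k => 1 / δ + δ - exp (-(δ * X k)) / δ with hw
  have hwpos : ∀ δ > 0, ∀ k, 0 < w δ k := fun δ hδ k => by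
    have : exp (-(δ * X k)) ≤ 1 := exp_le_one_iff.2 (by have := hX k; nlinarith)
    have : exp (-(δ * X k)) / δ ≤ 1 / δ := by gcongr
    simp only [hw]; linarith
  have hwlim : ∀ k, Filter.Tendsto (fun δ => w δ k) (nhdsWithin 0 (Ioi 0))
      (nhdsWithin (X k) (Ici 0)) := fun k =>
    tendsto_nhdsWithin_iff.2 ⟨tendsto_one_sub_exp_div (X k),
      eventually_nhdsWithin_of_forall fun δ hδ => (hwpos δ hδ k).le⟩
  have hlim : Filter.Tendsto
      (fun δ => ∑ k, (L (w δ k) * Y k + L' (w δ k) * exp (-(δ * X k)) * Z k))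
      (nhdsWithin 0 (Ioi 0)) (nhds (∑ k, (L (X k) * Y k + L' (X k) * Z k))) := by
    refine tendsto_finsetSum _ fun k _ => ?_
    have hexp : Filter.Tendsto (fun δ : ℝ => exp (-(δ * X k))) (nhdsWithin 0 (Ioi 0))
        (nhds 1) := by
      have : Continuous fun δ : ℝ => exp (-(δ * X k)) := by fun_prop
      simpa using (this.tendsto 0).mono_left nhdsWithin_le_nhds
    have h1 := ((hLc (X k) (hX k)).tendsto.comp (hwlim k)).mul_const (Y k)
    have h2 := ((((hL'c (X k) (hX k)).tendsto.comp (hwlim k)).mul hexp).mul_const (Z k))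
    simpa using h1.add h2
  refine ge_of_tendsto hlim (eventually_nhdsWithin_of_forall fun δ (hδ : 0 < δ) => ?_)
  set a := 1 / δ + δ
  set h : ℕ → ℝ → ℝ := fun n t => (-1) ^ n * iteratedDeriv n L (a - t) with hh
  have hd : ∀ n, ∀ t < a, HasDerivAt (h n) (h (n + 1) t) t := fun n t ht => by
    have h1 := hasDerivAt_iteratedDeriv_of_contDiffOn hLsm n (sub_pos.2 ht)
    have h2 := (h1.comp t ((hasDerivAt_id t).const_sub a)).const_mul ((-1) ^ n)
    refine h2.congr_deriv ?_
    simp only [hh]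
    ring
  have hpos : ∀ n, ∀ t < a, 0 ≤ h n t := fun n t ht => hcm n _ (sub_pos.2 ht)
  have ha0 : 0 < a := by positivity
  set c : ℕ → ℝ := fun j => h j 0 / (j.factorial : ℝ) with hcdef
  have hc : ∀ j, 0 ≤ c j := fun j => div_nonneg (hpos j 0 ha0) (by positivity)
  set y : κ → ℝ := fun k => exp (-(δ * X k)) / δ
  have hy0 : ∀ k, 0 ≤ y k := fun k => by positivity
  have hya : ∀ k, y k < a := fun k => by have := hwpos δ hδ k; simp only [hw] at this; linarith
  have hsum : ∀ k, HasSum (fun j : ℕ => c j * y k ^ j * (Y k - j * δ * Z k))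
      (L (w δ k) * Y k + L' (w δ k) * exp (-(δ * X k)) * Z k) := fun k => by
    have h1 := hasSum_taylor_of_nonneg hd hpos 0 (hy0 k) (hya k)
    have h2 := hasSum_taylor_of_nonneg hd hpos 1 (hy0 k) (hya k)
    have h3 : HasSum (fun j : ℕ => c j * (j * y k ^ j)) (h 1 (y k) * y k) := by
      refine (hasSum_nat_add_iff' 1).1 ?_
      rw [Finset.sum_range_one, Nat.cast_zero, zero_mul, mul_zero, sub_zero]
      refine (h2.mul_right (y k)).congr_fun fun j => ?_
      have : (j.factorial : ℝ) ≠ 0 := by positivity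
      simp only [hcdef, Nat.factorial_succ, add_comm 1 j]
      push_cast
      field_simp
      ring
    have hyw : a - y k = w δ k := rfl
    have h0k : h 0 (y k) = L (w δ k) := by simp [hh, hyw]
    have h1k : h 1 (y k) * (δ * y k) = -(L' (w δ k) * exp (-(δ * X k))) := by
      have : δ * y k = exp (-(δ * X k)) := mul_div_cancel₀ _ hδ.ne'
      rw [this, hL'eq _ (hwpos δ hδ k)]
      simp [hh, hyw]
    have h4 := (h1.mul_right (Y k)).sub (h3.mul_right (δ * Z k))
    have e : h 0 (y k) * Y k - h 1 (y k) * y k * (δ * Z k) =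
        L (w δ k) * Y k + L' (w δ k) * exp (-(δ * X k)) * Z k := by
      rw [h0k]
      linear_combination (-Z k) * h1k
    rw [e] at h4
    refine h4.congr_fun fun j => ?_
    simp only [hcdef, zero_add]
    ring
  refine (hasSum_sum fun k _ => hsum k).nonneg fun j => ?_
  have hpow : ∀ k, y k ^ j = exp (-(j * δ * X k)) / δ ^ j := fun k => by
    rw [div_pow, ← exp_nat_mul]
    ring_nf
  have h1 := mul_nonneg (div_nonneg (hc j) (pow_nonneg hδ.le j)) (H (j * δ) (by positivity))
  rw [Finset.mul_sum] at h1
  refine h1.trans_eq (Finset.sum_congr rfl fun k _ => ?_)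
  rw [hpow]
  ring

section Kernels

variable {ι : Type*} [Fintype ι]

lemma sum_exp_nonneg_of_posSemidef {B : Matrix ι ι ℝ} (hB : B.PosSemidef) (b : ι → ℝ) :
    0 ≤ ∑ k, ∑ l, b k * b l * exp (B k l) := by
  have hpow : ∀ n : ℕ, (Matrix.of fun k l => B k l ^ n).PosSemidef := by
    intro n
    induction n with
    | zero =>
      convert Matrix.posSemidef_vecMulVec_self_star (fun _ : ι => (1 : ℝ)) using 1
      ext k l
      simp [vecMulVec_apply]
    | succ n ih =>
      have e : (Matrix.of fun k l => B k l ^ (n + 1)) =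
          (Matrix.of fun k l => B k l ^ n) ⊙ B := by
        ext k l
        simp [pow_succ]
      rw [e]
      exact ih.hadamard hB
  have hsum : HasSum (fun n : ℕ => ∑ k, ∑ l, b k * b l * (B k l ^ n / (n.factorial : ℝ)))
      (∑ k, ∑ l, b k * b l * exp (B k l)) := by
    refine hasSum_sum fun k _ => hasSum_sum fun l _ => HasSum.mul_left _ ?_
    rw [Real.exp_eq_exp_ℝ]
    exact NormedSpace.expSeries_div_hasSum_exp _
  refine hsum.nonneg fun n => ?_
  have h1 := div_nonneg ((hpow n).dotProduct_mulVec_nonneg b)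
    (by positivity : (0 : ℝ) ≤ n.factorial)
  convert h1 using 1
  simp only [dotProduct, mulVec, Finset.mul_sum, Finset.sum_div, Matrix.of_apply, star_trivial]
  refine Finset.sum_congr rfl fun k _ => Finset.sum_congr rfl fun l _ => ?_
  ring

/-- Schoenberg's theorem: `exp (-s A)` is positive semidefinite for conditionally negative
definite `A`. -/
lemma sum_exp_neg_nonneg_of_condNegDef {A : ι → ι → ℝ} (hsymm : ∀ k l, A k l = A l k)
    (hA : ∀ b : ι → ℝ, ∑ k, b k = 0 → ∑ k, ∑ l, b k * b l * A k l ≤ 0) {s : ℝ} (hs : 0 ≤ s)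
    (b : ι → ℝ) : 0 ≤ ∑ k, ∑ l, b k * b l * exp (-(s * A k l)) := by
  classical
  rcases isEmpty_or_nonempty ι with _ | ⟨⟨o⟩⟩
  · simp
  set B : Matrix ι ι ℝ := Matrix.of fun k l => s * (A k o + A o l - A k l - A o o) with hBdef
  have hB : B.PosSemidef := by
    refine .of_dotProduct_mulVec_nonneg ?_ fun v => ?_
    · ext k l
      simp only [hBdef, conjTranspose_apply, Matrix.of_apply, star_trivial]
      rw [hsymm l o, hsymm o k, hsymm l k]
      ring
    · have h1 := hA (fun k => v k - (∑ j, v j) * (Pi.single o 1 : ι → ℝ) k)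
        (by simp [← Finset.mul_sum])
      have h2 : star v ⬝ᵥ (B *ᵥ v) = s * -(∑ k, ∑ l,
          (v k - (∑ j, v j) * (Pi.single o 1 : ι → ℝ) k) *
          (v l - (∑ j, v j) * (Pi.single o 1 : ι → ℝ) l) * A k l) := by
        have e1 : ∑ k, ∑ l, (v k - (∑ j, v j) * (Pi.single o 1 : ι → ℝ) k) *
          (v l - (∑ j, v j) * (Pi.single o 1 : ι → ℝ) l) * A k l =
          ∑ k, ∑ l, v k * v l * A k l - (∑ j, v j) * ∑ k, v k * A k o
          - (∑ j, v j) * ∑ l, v l * A o l + (∑ j, v j) * (∑ j, v j) * A o o := by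
          have hδ : ∀ g : ι → ℝ, ∑ k, (v k - (∑ j, v j) * (Pi.single o 1 : ι → ℝ) k) * g k =
              ∑ k, v k * g k - (∑ j, v j) * g o := fun g => by
            simp [sub_mul, Pi.single_apply]
          simp only [mul_assoc, ← Finset.mul_sum, hδ]
          simp only [mul_sub, Finset.sum_sub_distrib, mul_left_comm _ (∑ j, v j),
            ← Finset.mul_sum]
          ring
        have e2 : star v ⬝ᵥ (B *ᵥ v) = s * ((∑ j, v j) * ∑ k, v k * A k o
          + (∑ j, v j) * ∑ l, v l * A o l - ∑ k, ∑ l, v k * v l * A k l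
          - (∑ j, v j) * (∑ j, v j) * A o o) := by
          rw [mul_comm (∑ j, v j) (∑ l, v l * A o l)]
          simp only [dotProduct, mulVec, hBdef, Matrix.of_apply, star_trivial,
            Finset.sum_mul, Finset.mul_sum, ← Finset.sum_add_distrib, ← Finset.sum_sub_distrib]
          refine Finset.sum_congr rfl fun k _ => Finset.sum_congr rfl fun l _ => ?_
          ring
        rw [e1, e2]
        ring
      rw [h2]
      exact mul_nonneg hs (by linarith)
  have h := mul_nonneg (exp_pos (s * A o o)).le
    (sum_exp_nonneg_of_posSemidef hB fun k => b k * exp (-(s * A k o)))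
  refine h.trans_eq ?_
  simp only [Finset.mul_sum]
  refine Finset.sum_congr rfl fun k _ => Finset.sum_congr rfl fun l _ => ?_
  have : exp (-(s * A k l)) = exp (s * A o o) * exp (-(s * A k o)) * exp (-(s * A l o))
      * exp (B k l) := by
    rw [← exp_add, ← exp_add, ← exp_add]
    simp only [hBdef, Matrix.of_apply, hsymm l o]
    ring_nf
  rw [this]
  ring

end Kernels

/-- A function with a global minimum at `0` has a nonnegative second derivative there. -/
lemma second_deriv_nonneg_of_min {q q' : ℝ → ℝ} {q'' : ℝ} (hq : ∀ t, HasDerivAt q (q' t) t)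
    (hq' : HasDerivAt q' q'' 0) (hmin : ∀ t, q 0 ≤ q t) : 0 ≤ q'' := by
  by_contra! hneg
  have hd : deriv q = q' := funext fun t => (hq t).deriv
  have h0 : deriv q 0 = 0 := IsLocalMin.deriv_eq_zero (Filter.Eventually.of_forall hmin)
  have hmax : IsLocalMax q 0 := isLocalMax_of_deriv_deriv_neg
    (by rwa [hd, hq'.deriv]) h0 (hq 0).continuousAt
  have hconst : q =ᶠ[nhds 0] fun _ => q 0 :=
    hmax.mono fun t ht => le_antisymm ht (hmin t)
  have h1 := hconst.deriv.deriv_eq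
  rw [hd, hq'.deriv] at h1
  simp at h1
  exact hneg.ne h1

/-- The quadratic form inequality of conditional negative definiteness, for functions with two
component indices and points paired with a component index. -/
def IsCondNegDefFlat {V : Type*} [AddCommGroup V] {m : ℕ} (G : V → Fin m → Fin m → ℝ) : Prop :=
  ∀ (ι : Type) [Fintype ι] (z : ι → V) (c : ι → Fin m) (b : ι → ℝ), ∑ k, b k = 0 →
    ∑ k, ∑ l, b k * b l * G (z k - z l) (c k) (c l) ≤ 0

lemma IsPseudoCrossVariogram.isCondNegDefFlat {V : Type*} [AddCommGroup V] {m : ℕ}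
    {γ : V → Matrix (Fin m) (Fin m) ℝ} (hγ : IsPseudoCrossVariogram γ) :
    IsCondNegDefFlat γ := by
  intro ι _ z c b hb
  have e := Fintype.equivFin ι
  have h := hγ.1.2 (Fintype.card ι) (fun p => z (e.symm p))
    (fun p => Pi.single (c (e.symm p)) (b (e.symm p)))
    (by simpa [e.symm.sum_comp b] using hb)
  refine le_of_eq_of_le ?_ h
  rw [← e.symm.sum_comp]
  refine Finset.sum_congr rfl fun p _ => ?_
  rw [← e.symm.sum_comp]
  refine Finset.sum_congr rfl fun q _ => ?_
  simp [single_dotProduct, mulVec_single]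
  ring

lemma IsPseudoCrossVariogram.nonneg {V : Type*} [AddCommGroup V] {m : ℕ}
    {γ : V → Matrix (Fin m) (Fin m) ℝ} (hγ : IsPseudoCrossVariogram γ) (v : V) (i j : Fin m) :
    0 ≤ γ v i j := by
  have h := hγ.isCondNegDefFlat Bool (fun t => if t then v else 0) (fun t => if t then i else j)
    (fun t => if t then 1 else -1) (by simp)
  have hs := hγ.1.1 v 0 i j
  simp [hγ.2] at h hs
  linarith

lemma IsCondNegDefFlat.neg_exp {V : Type*} [AddCommGroup V] {m : ℕ}
    {G : V → Fin m → Fin m → ℝ} (hG : IsCondNegDefFlat G) (hsymm : ∀ v i j, G v i j = G (-v) j i)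
    {s : ℝ} (hs : 0 ≤ s) : IsCondNegDefFlat fun v i j => -exp (-(s * G v i j)) := by
  intro ι _ z c b _
  have := sum_exp_neg_nonneg_of_condNegDef (A := fun k l => G (z k - z l) (c k) (c l))
    (fun k l => by rw [hsymm, neg_sub]) (fun b hb => hG ι z c b hb) hs b
  simpa using this

/-- The second derivative in the last variable of a symmetric conditionally negative definite
function is positive definite. -/
lemma IsCondNegDefFlat.sum_deriv_deriv_nonneg {E : Type*} [AddCommGroup E] {m : ℕ}
    {G G₁ G₂ : E × ℝ → Fin m → Fin m → ℝ} (hG : IsCondNegDefFlat G)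
    (hsymm : ∀ v i j, G v i j = G (-v) j i)
    (h₁ : ∀ h i j t, HasDerivAt (fun t => G (h, t) i j) (G₁ (h, t) i j) t)
    (h₂ : ∀ h i j t, HasDerivAt (fun t => G₁ (h, t) i j) (G₂ (h, t) i j) t)
    {ι : Type} [Fintype ι] (z : ι → E × ℝ) (c : ι → Fin m) (b : ι → ℝ) :
    0 ≤ ∑ k, ∑ l, b k * b l * G₂ (z k - z l) (c k) (c l) := by
  have hshift : ∀ (v : E × ℝ) (t : ℝ), HasDerivAt (fun t => v.2 + t) 1 t := fun v t => by
    simpa using (hasDerivAt_id t).const_add v.2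
  have hv : ∀ (v : E × ℝ) (t : ℝ), v + (0, t) = (v.1, v.2 + t) := fun v t => by ext <;> simp
  have hv0 : ∀ v : E × ℝ, v = (v.1, v.2 + 0) := fun v => by ext <;> simp
  refine second_deriv_nonneg_of_min
    (q := fun t => ∑ k, ∑ l, b k * b l * G (z k - z l + (0, t)) (c k) (c l))
    (q' := fun t => ∑ k, ∑ l, b k * b l * G₁ (z k - z l + (0, t)) (c k) (c l)) ?_ ?_ ?_
  · intro t
    refine HasDerivAt.fun_sum fun k _ => HasDerivAt.fun_sum fun l _ => HasDerivAt.const_mul _ ?_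
    simp only [hv]
    simpa [Function.comp_def] using (h₁ (z k - z l).1 (c k) (c l) _).comp t (hshift (z k - z l) t)
  · refine HasDerivAt.fun_sum fun k _ => HasDerivAt.fun_sum fun l _ => HasDerivAt.const_mul _ ?_
    rw [hv0 (z k - z l)]
    simp only [hv]
    simpa [Function.comp_def] using (h₂ (z k - z l).1 (c k) (c l) _).comp 0 (hshift (z k - z l) 0)
  · intro t
    have heven : ∑ k, ∑ l, b k * b l * G (z k - z l - (0, t)) (c k) (c l) =
        ∑ k, ∑ l, b k * b l * G (z k - z l + (0, t)) (c k) (c l) := by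
      rw [Finset.sum_comm]
      refine Finset.sum_congr rfl fun k _ => Finset.sum_congr rfl fun l _ => ?_
      rw [hsymm, mul_comm (b l), show -(z l - z k - (0, t)) = z k - z l + (0, t) by abel]
    have h := hG (ι × Bool) (fun p => z p.1 + if p.2 then (0, t) else 0) (fun p => c p.1)
      (fun p => b p.1 * if p.2 then 1 else -1) (by simp [Fintype.sum_prod_type])
    have e : ∀ k l, z k + (0, t) - (z l + (0, t)) = z k - z l ∧ z k + (0, t) - z l =
      z k - z l + (0, t) ∧ z k - (z l + (0, t)) = z k - z l - (0, t) := fun k l =>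
      ⟨by abel, by abel, by abel⟩
    simp only [Fintype.sum_prod_type, Fintype.sum_bool, if_true, Bool.false_eq_true, if_false,
      add_zero, e, Finset.sum_add_distrib, mul_one, mul_neg, neg_mul,
      Finset.sum_neg_distrib, heven] at h
    have z0 : ∀ v : E × ℝ, v + (0, 0) = v := fun v => by simp
    simp only [z0]
    linarith

/-- Let `L` be the continuous extension of a completely monotone function on
`[0,∞)` whose derivative `L'` also extends continuously to `[0,∞)`, and let `γ` be a
space-time pseudo cross-variogram with twice continuously differentiable components. Then
the function with entries
`C_ij(h,u) = L(γ_ij(h,u)) ∂²γ_ij(h,u)/∂u² + L'(γ_ij(h,u)) (∂γ_ij(h,u)/∂u)²` is positive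
definite. -/
theorem completely_monotone_derivative_posdef {d m : ℕ}
    (L L' : ℝ → ℝ)
    (hLc : ContinuousOn L (Ici 0))
    (hLsm : ContDiffOn ℝ (⊤ : ℕ∞) L (Ioi 0))
    (hcm : ∀ (n : ℕ) (x : ℝ), 0 < x → 0 ≤ (-1 : ℝ) ^ n * iteratedDeriv n L x)
    (hL'c : ContinuousOn L' (Ici 0))
    (hL'eq : ∀ x : ℝ, 0 < x → L' x = deriv L x)
    (γ : ((Fin d → ℝ) × ℝ) → Matrix (Fin m) (Fin m) ℝ)
    (hγ : IsPseudoCrossVariogram γ)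
    (hC2 : ∀ i j, ContDiff ℝ 2 fun hu : (Fin d → ℝ) × ℝ => γ hu i j) :
    IsPosDefFun (fun hu : (Fin d → ℝ) × ℝ => Matrix.of fun i j =>
      L (γ hu i j) * iteratedDeriv 2 (fun t : ℝ => γ (hu.1, t) i j) hu.2 +
      L' (γ hu i j) * (deriv (fun t : ℝ => γ (hu.1, t) i j) hu.2) ^ 2) := by
  have hsymm : ∀ v i j, γ v i j = γ (-v) j i := fun v i j => by simpa using hγ.1.1 v 0 i j
  set γ₁ : (Fin d → ℝ) × ℝ → Fin m → Fin m → ℝ :=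
    fun hu i j => deriv (fun t : ℝ => γ (hu.1, t) i j) hu.2 with hγ₁
  set γ₂ : (Fin d → ℝ) × ℝ → Fin m → Fin m → ℝ :=
    fun hu i j => iteratedDeriv 2 (fun t : ℝ => γ (hu.1, t) i j) hu.2 with hγ₂
  have hC : ∀ h i j, ContDiff ℝ 2 fun t : ℝ => γ (h, t) i j := fun h i j =>
    (hC2 i j).comp (contDiff_const.prodMk contDiff_id)
  have hd₁ : ∀ h i j t, HasDerivAt (fun t => γ (h, t) i j) (γ₁ (h, t) i j) t := fun h i j t =>
    ((hC h i j).differentiable (by norm_num) t).hasDerivAt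
  have hd₂ : ∀ h i j t, HasDerivAt (fun t => γ₁ (h, t) i j) (γ₂ (h, t) i j) t := fun h i j t => by
    have := ((hC h i j).differentiable_iteratedDeriv 1 (by norm_num) t).hasDerivAt
    rw [← iteratedDeriv_succ, iteratedDeriv_one] at this
    exact this
  have hfun : ∀ h i j, (fun t => γ (h, t) i j) = fun t => γ (-h, -t) j i := fun h i j =>
    funext fun t => hsymm (h, t) i j
  have hsymm₁ : ∀ v i j, γ₁ v i j = -γ₁ (-v) j i := fun v i j => by
    simp only [hγ₁]
    rw [hfun, deriv_comp_neg (fun t => γ (-v.1, t) j i)]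
    simp
  have hsymm₂ : ∀ v i j, γ₂ v i j = γ₂ (-v) j i := fun v i j => by
    simp only [hγ₂]
    rw [hfun, iteratedDeriv_comp_neg 2 (fun t => γ (-v.1, t) j i)]
    simp
  refine ⟨fun x y i j => ?_, fun n x a => ?_⟩
  · change L (γ (x - y) i j) * γ₂ (x - y) i j + L' (γ (x - y) i j) * γ₁ (x - y) i j ^ 2 =
      L (γ (y - x) j i) * γ₂ (y - x) j i + L' (γ (y - x) j i) * γ₁ (y - x) j i ^ 2
    rw [hsymm, hsymm₁, hsymm₂, neg_sub, neg_sq]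
  · let z : Fin n × Fin m → (Fin d → ℝ) × ℝ := fun k => x k.1
    let b : Fin n × Fin m → ℝ := fun k => a k.1 k.2
    let v : (Fin n × Fin m) × (Fin n × Fin m) → (Fin d → ℝ) × ℝ := fun p => z p.1 - z p.2
    have key := sum_completelyMonotone_nonneg hLc hLsm hcm hL'c hL'eq
      (κ := (Fin n × Fin m) × (Fin n × Fin m))
      (fun p => γ (v p) p.1.2 p.2.2)
      (fun p => b p.1 * b p.2 * γ₂ (v p) p.1.2 p.2.2)
      (fun p => b p.1 * b p.2 * γ₁ (v p) p.1.2 p.2.2 ^ 2)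
      (fun p => hγ.nonneg _ _ _) ?_
    · refine key.trans_eq ?_
      simp only [Fintype.sum_prod_type, dotProduct, mulVec, Matrix.of_apply, Finset.mul_sum]
      refine Finset.sum_congr rfl fun p _ => ?_
      rw [Finset.sum_comm]
      refine Finset.sum_congr rfl fun q _ => Finset.sum_congr rfl fun i _ =>
        Finset.sum_congr rfl fun j _ => ?_
      simp only [b, v, z, hγ₁, hγ₂]
      ring
    · intro s hs
      rw [Fintype.sum_prod_type]
      rcases hs.eq_or_lt with rfl | hs
      · simpa [v] using hγ.isCondNegDefFlat.sum_deriv_deriv_nonneg hsymm hd₁ hd₂ z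
          (fun k => k.2) b
      · have h := (hγ.isCondNegDefFlat.neg_exp hsymm hs.le).sum_deriv_deriv_nonneg
          (G₁ := fun v i j => s * (exp (-(s * γ v i j)) * γ₁ v i j))
          (G₂ := fun v i j => s * (exp (-(s * γ v i j)) * (γ₂ v i j - s * γ₁ v i j ^ 2)))
          (fun v i j => by rw [hsymm])
          (fun h i j t => by
            refine (((hd₁ h i j t).const_mul s).fun_neg.exp).fun_neg.congr_deriv ?_
            ring)
          (fun h i j t => by
            refine (((((hd₁ h i j t).const_mul s).fun_neg.exp).fun_mul
              (hd₂ h i j t)).const_mul s).congr_deriv ?_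
            ring) z (fun k => k.2) b
        refine nonneg_of_mul_nonneg_right (h.trans_eq ?_) hs
        simp only [Finset.mul_sum]
        refine Finset.sum_congr rfl fun k _ => Finset.sum_congr rfl fun l _ => ?_
        simp only [v]
        ring
end

section
/- Let g: [0,∞) → ℝ^{m×m} be a continuous matrix-valued function whose component functions g_ij are twice continuously differentiable on [0,∞), and suppose that the function γ: ℝ^{d+1} → ℝ^{m×m} with γ_ij(h) = g_ij(‖h‖²) is a (isotropic) pseudo cross-variogram on ℝ^{d+1}. Then the matrix-valued function C: ℝ^d → ℝ^{m×m} with entries C_ij(h) = g′_ij(‖h‖²), i,j = 1,…,m, is positive definite on ℝ^d. -/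
open Matrix MeasureTheory Real Set
open scoped BigOperators

/-- The point `(s, x)` of `ℝ^{d+1}`. -/
def consPoint {d : ℕ} (s : ℝ) (x : EuclideanSpace ℝ (Fin d)) : EuclideanSpace ℝ (Fin (d + 1)) :=
  WithLp.toLp 2 (Fin.cons s x.ofLp)

lemma norm_sq_consPoint_sub {d : ℕ} (s t : ℝ) (x y : EuclideanSpace ℝ (Fin d)) :
    ‖consPoint s x - consPoint t y‖ ^ 2 = ‖x - y‖ ^ 2 + (s - t) ^ 2 := by
  simp [EuclideanSpace.norm_sq_eq, consPoint, Fin.sum_univ_succ, add_comm]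

/-- A function on `[0,∞)` with a global minimum at `0` has nonnegative one-sided derivative. -/
lemma HasDerivWithinAt.nonneg_of_forall_ge {F : ℝ → ℝ} {F' : ℝ}
    (hF : HasDerivWithinAt F F' (Ici 0) 0) (h : ∀ t, 0 ≤ t → F 0 ≤ F t) : 0 ≤ F' := by
  have hs := (hasDerivWithinAt_iff_tendsto_slope' (s := Ioi (0 : ℝ)) (by simp)).1
    (hF.mono Ioi_subset_Ici_self)
  refine ge_of_tendsto hs (Filter.eventually_of_mem self_mem_nhdsWithin fun t ht => ?_)
  have ht' : 0 < t := ht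
  rw [slope_def_field, sub_zero]
  exact div_nonneg (sub_nonneg.2 (h t ht'.le)) ht'.le

/-- The quadratic form of an isotropic pseudo cross-variogram on `ℝ^{d+1}`, evaluated at points of
`ℝ^d`, does not decrease when all squared distances are increased by the same amount. -/
lemma IsPseudoCrossVariogram.quadForm_le_shift {d m : ℕ} {g : ℝ → Matrix (Fin m) (Fin m) ℝ}
    (hγ : IsPseudoCrossVariogram fun h : EuclideanSpace ℝ (Fin (d + 1)) => g (‖h‖ ^ 2))
    {n : ℕ} (x : Fin n → EuclideanSpace ℝ (Fin d)) (a : Fin n → Fin m → ℝ) {t : ℝ} (ht : 0 ≤ t) :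
    ∑ p, ∑ q, a p ⬝ᵥ (g (‖x p - x q‖ ^ 2)).mulVec (a q) ≤
      ∑ p, ∑ q, a p ⬝ᵥ (g (‖x p - x q‖ ^ 2 + t)).mulVec (a q) := by
  have h := hγ.1.2 (n + n)
    (Fin.append (fun p => consPoint 0 (x p)) (fun p => consPoint (√t) (x p)))
    (Fin.append a (fun p => -a p))
    (by simp only [Fin.sum_univ_add, Fin.append_left, Fin.append_right, Pi.neg_apply,
          Finset.sum_neg_distrib, add_neg_cancel])
  simp only [Fin.sum_univ_add, Fin.append_left, Fin.append_right, norm_sq_consPoint_sub,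
    mulVec_neg, dotProduct_neg, neg_dotProduct, sub_self, zero_sub, sub_zero, neg_sq,
    Real.sq_sqrt ht, Finset.sum_add_distrib, Finset.sum_neg_distrib, ne_eq, OfNat.ofNat_ne_zero,
    not_false_eq_true, zero_pow, add_zero] at h
  linarith

lemma IsPseudoCrossVariogram.isotropic_symm {d m : ℕ} {g : ℝ → Matrix (Fin m) (Fin m) ℝ}
    (hγ : IsPseudoCrossVariogram fun h : EuclideanSpace ℝ (Fin (d + 1)) => g (‖h‖ ^ 2))
    {t : ℝ} (ht : 0 ≤ t) (i j : Fin m) : g t i j = g t j i := by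
  have h := hγ.1.1 (consPoint (√t) 0) (consPoint 0 0) i j
  simpa [norm_sq_consPoint_sub, Real.sq_sqrt ht] using h

/-- Let `g : [0,∞) → ℝ^{m×m}` be continuous with twice continuously
differentiable components on `[0,∞)`, such that `h ↦ g(‖h‖²)` is an isotropic pseudo
cross-variogram on `ℝ^{d+1}`. Then the function with entries `C_ij(h) = g′_ij(‖h‖²)` is
positive definite on `ℝ^d`. -/
theorem isotropic_derivative_posdef {d m : ℕ}
    (g : ℝ → Matrix (Fin m) (Fin m) ℝ)
    (hgc : ∀ i j, ContinuousOn (fun t => g t i j) (Ici 0))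
    (hg2 : ∀ i j, ContDiffOn ℝ 2 (fun t => g t i j) (Ici 0))
    (hγ : IsPseudoCrossVariogram fun h : EuclideanSpace ℝ (Fin (d + 1)) => g (‖h‖ ^ 2)) :
    IsPosDefFun (fun h : EuclideanSpace ℝ (Fin d) => Matrix.of fun i j =>
      derivWithin (fun t => g t i j) (Ici 0) (‖h‖ ^ 2)) := by
  refine ⟨fun x y i j => ?_, fun n x a => ?_⟩
  · simp only [Matrix.of_apply, norm_sub_rev x y]
    exact derivWithin_congr (fun t ht => hγ.isotropic_symm ht i j)
      (hγ.isotropic_symm (sq_nonneg _) i j)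
  · have hd (r : ℝ) (hr : 0 ≤ r) (i j : Fin m) : HasDerivWithinAt (fun t => g (r + t) i j)
        (derivWithin (fun t => g t i j) (Ici 0) r) (Ici 0) 0 := by
      have h1 := ((hg2 i j).differentiableOn (by norm_num) r hr).hasDerivWithinAt
      have h2 : HasDerivWithinAt (fun t : ℝ => r + t) 1 (Ici 0) 0 :=
        (hasDerivWithinAt_id _ _).const_add r
      simpa [Function.comp_def] using HasDerivWithinAt.comp_of_eq (h₂ := fun t => g t i j) 0 h1 h2
        (fun t (ht : 0 ≤ t) => add_nonneg hr ht) (add_zero r).symm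
    refine HasDerivWithinAt.nonneg_of_forall_ge
      (F := fun t => ∑ p, ∑ q, a p ⬝ᵥ (g (‖x p - x q‖ ^ 2 + t)).mulVec (a q)) ?_
      fun t ht => by simpa using hγ.quadForm_le_shift x a ht
    simp only [dotProduct, mulVec, Matrix.of_apply]
    exact HasDerivWithinAt.fun_sum fun p _ => HasDerivWithinAt.fun_sum fun q _ =>
      HasDerivWithinAt.fun_sum fun i _ => HasDerivWithinAt.const_mul _ <|
      HasDerivWithinAt.fun_sum fun j _ => (hd _ (sq_nonneg _) i j).mul_const _
end

section
/- Let Γ: ℝ^d × ℝ^d → [0,∞)^{m×m} be a conditionally negative definite matrix-valued kernel with nonnegative entries (in particular, Γ may be the kernel (x,y) ↦ γ(x−y) of a pseudo cross-variogram γ). Then for every ν ∈ [0,1], the matrix-valued kernel C: ℝ^d × ℝ^d → ℝ^{m×m} with entries C_ij(x,y) = cosh(ν·√(γ_ij(x,y))) / cosh(√(γ_ij(x,y))), i,j = 1,…,m, is positive definite; in particular, for ν = 0 the kernel with entries 1 / cosh(√(γ_ij(x,y))) is positive definite. -/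
open Matrix MeasureTheory Real Set
open scoped BigOperators

open Filter Topology Finset

namespace Matrix

variable {ι : Type*} [Fintype ι]

theorem posSemidef_iff_sum_sum_nonneg {M : Matrix ι ι ℝ} :
    M.PosSemidef ↔ (∀ a b, M a b = M b a) ∧
      ∀ v : ι → ℝ, 0 ≤ ∑ a, ∑ b, v a * M a b * v b := by
  rw [posSemidef_iff_dotProduct_mulVec]
  refine and_congr ⟨fun h a b => ?_, fun h => ?_⟩ (forall_congr' fun v => ?_)
  · simpa using h.apply b a
  · ext a b
    simpa using h b a
  · simp [dotProduct, mulVec, Finset.mul_sum, mul_assoc]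

theorem posSemidef_of_tendsto {M : ℕ → Matrix ι ι ℝ} {N : Matrix ι ι ℝ}
    (hM : ∀ k, (M k).PosSemidef) (h : ∀ a b, Tendsto (fun k => M k a b) atTop (𝓝 (N a b))) :
    N.PosSemidef := by
  simp only [posSemidef_iff_sum_sum_nonneg] at hM ⊢
  refine ⟨fun a b => tendsto_nhds_unique (h a b) ?_, fun v => ?_⟩
  · simpa only [(hM _).1 a b] using h b a
  · refine ge_of_tendsto' (tendsto_finsetSum _ fun a _ => tendsto_finsetSum _ fun b _ =>
      ((h a b).const_mul (v a)).mul_const (v b)) fun k => (hM k).2 v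

theorem posSemidef_of_one : (of fun _ _ => 1 : Matrix ι ι ℝ).PosSemidef := by
  simpa [vecMulVec] using! posSemidef_vecMulVec_self_star (fun _ : ι => (1 : ℝ))

theorem posSemidef_of_prod {κ : Type*} (s : Finset κ) {M : κ → Matrix ι ι ℝ}
    (hM : ∀ k ∈ s, (M k).PosSemidef) : (of fun a b => ∏ k ∈ s, M k a b).PosSemidef := by
  classical
  induction s using Finset.induction_on with
  | empty => simpa using posSemidef_of_one
  | insert k s hk ih =>
    simp only [Finset.prod_insert hk]
    exact (hM k (by simp)).hadamard (ih fun j hj => hM j (by simp [hj]))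

theorem PosSemidef.map_exp_s19 {M : Matrix ι ι ℝ} (hM : M.PosSemidef) :
    (M.map Real.exp).PosSemidef := by
  refine posSemidef_of_tendsto
    (M := fun n => ∑ k ∈ range n, ((k.factorial : ℝ)⁻¹ • of fun a b => ∏ _j ∈ range k, M a b))
    (fun n => posSemidef_sum _ fun k _ =>
      (posSemidef_of_prod (M := fun _ => M) _ fun _ _ => hM).smul (by positivity)) fun a b => ?_
  have h := (NormedSpace.expSeries_div_hasSum_exp (M a b)).tendsto_sum_nat
  rw [← Real.exp_eq_exp_ℝ] at h
  simpa [Matrix.sum_apply, div_eq_inv_mul] using h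

/-- A symmetric matrix is conditionally negative definite if its quadratic form is nonpositive
on vectors whose entries sum to zero. -/
def IsCondNegDef (G : Matrix ι ι ℝ) : Prop :=
  (∀ a b, G a b = G b a) ∧
    ∀ v : ι → ℝ, ∑ a, v a = 0 → ∑ a, ∑ b, v a * G a b * v b ≤ 0

namespace IsCondNegDef

variable {G : Matrix ι ι ℝ}

theorem posSemidef_of_sub (hG : G.IsCondNegDef) (o : ι) :
    (of fun a b => G a o + G o b - G a b - G o o).PosSemidef := by
  classical
  rw [posSemidef_iff_sum_sum_nonneg]
  refine ⟨fun a b => ?_, fun v => ?_⟩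
  · simp only [of_apply]
    rw [hG.1 a o, hG.1 o b, hG.1 a b]
    ring
  · have h := hG.2 (fun a => v a - if a = o then ∑ b, v b else 0) (by simp)
    have h1 : ∀ a, ∑ b, (v a - if a = o then ∑ b, v b else 0) * G a b *
        (v b - if b = o then ∑ c, v c else 0) =
        (v a - if a = o then ∑ b, v b else 0) * (∑ b, G a b * v b - G a o * ∑ c, v c) := by
      intro a
      simp [mul_assoc, ← Finset.mul_sum, mul_sub, Finset.sum_sub_distrib]
    simp only [h1] at h
    simp only [sub_mul, ite_mul, zero_mul, Finset.sum_sub_distrib, Finset.sum_ite_eq',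
      Finset.mem_univ, if_true, mul_sub] at h
    simp only [of_apply, mul_sub, mul_add, sub_mul, add_mul, Finset.sum_sub_distrib,
      Finset.sum_add_distrib, mul_assoc, ← Finset.mul_sum] at h ⊢
    have h2 : ∑ a, v a * (G a o * ∑ c, v c) = (∑ c, v c) * ∑ b, G o b * v b := by
      rw [Finset.mul_sum]
      refine Finset.sum_congr rfl fun a _ => ?_
      rw [hG.1 a o]
      ring
    rw [h2] at h ⊢
    rw [← Finset.sum_mul, ← Finset.sum_mul]
    linarith

theorem posSemidef_exp_neg_mul (hG : G.IsCondNegDef) {t : ℝ} (ht : 0 ≤ t) :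
    (of fun a b => Real.exp (-(t * G a b))).PosSemidef := by
  rcases isEmpty_or_nonempty ι with _ | ⟨⟨o⟩⟩
  · exact posSemidef_iff_sum_sum_nonneg.2 ⟨fun a => isEmptyElim a, fun v => by simp⟩
  have h := ((hG.posSemidef_of_sub o).smul ht).map_exp_s19.hadamard
    (posSemidef_vecMulVec_self_star fun a => Real.exp (-(t * (G a o - G o o / 2))))
  refine (congrArg PosSemidef ?_).mpr h
  ext a b
  simp only [of_apply, hadamard_apply, map_apply, smul_apply, smul_eq_mul, vecMulVec_apply,
    star_trivial, ← Real.exp_add]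
  rw [hG.1 b o]
  ring_nf

theorem posSemidef_inv_add (hG : G.IsCondNegDef) (h0 : ∀ a b, 0 ≤ G a b) {c : ℝ} (hc : 0 < c) :
    (of fun a b => (c + G a b)⁻¹).PosSemidef := by
  rw [posSemidef_iff_sum_sum_nonneg]
  refine ⟨fun a b => by simp [hG.1 a b], fun v => ?_⟩
  have hneg (a b : ι) : -(c + G a b) < 0 := by linarith [h0 a b]
  have hint (a b : ι) : IntegrableOn
      (fun s => v a * Real.exp (-(c + G a b) * s) * v b) (Ioi 0) :=
    ((integrableOn_exp_mul_Ioi (hneg a b) 0).const_mul (v a)).mul_const (v b)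
  have heq : ∑ a, ∑ b, v a * (of fun a b => (c + G a b)⁻¹) a b * v b =
      ∫ s in Ioi (0 : ℝ), ∑ a, ∑ b, v a * Real.exp (-(c + G a b) * s) * v b := by
    rw [integral_finsetSum _ fun a _ => integrable_finsetSum _ fun b _ => hint a b]
    refine Finset.sum_congr rfl fun a _ => ?_
    rw [integral_finsetSum _ fun b _ => hint a b]
    refine Finset.sum_congr rfl fun b _ => ?_
    rw [integral_mul_const, integral_const_mul, integral_exp_mul_Ioi (hneg a b)]
    rw [mul_zero, Real.exp_zero, neg_div_neg_eq, one_div, of_apply]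
  rw [heq]
  refine setIntegral_nonneg measurableSet_Ioi fun s hs => ?_
  have h := (posSemidef_iff_sum_sum_nonneg.1 (hG.posSemidef_exp_neg_mul (le_of_lt hs))).2 v
  have he : ∑ a, ∑ b, v a * Real.exp (-(c + G a b) * s) * v b =
      Real.exp (-(c * s)) * ∑ a, ∑ b, v a * Real.exp (-(s * G a b)) * v b := by
    simp only [Finset.mul_sum]
    refine Finset.sum_congr rfl fun a _ => Finset.sum_congr rfl fun b _ => ?_
    rw [show -(c + G a b) * s = -(c * s) + -(s * G a b) by ring, Real.exp_add]
    ring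
  rw [he]
  exact mul_nonneg (Real.exp_pos _).le h

theorem posSemidef_one_add_div (hG : G.IsCondNegDef) (h0 : ∀ a b, 0 ≤ G a b) {c μ : ℝ}
    (hc : 0 < c) (hμ0 : 0 ≤ μ) (hμ1 : μ ≤ 1) :
    (of fun a b => (1 + μ * G a b / c) / (1 + G a b / c)).PosSemidef := by
  have h := (posSemidef_of_one (ι := ι)).smul hμ0 |>.add
    ((hG.posSemidef_inv_add h0 hc).smul (mul_nonneg (sub_nonneg.2 hμ1) hc.le))
  convert h using 1
  ext a b
  have : 0 < c + G a b := add_pos_of_pos_of_nonneg hc (h0 a b)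
  simp only [of_apply, add_apply, smul_apply, smul_eq_mul]
  field_simp
  ring

end IsCondNegDef

end Matrix

namespace Real

theorem tendsto_euler_sinh_prod (s : ℝ) :
    Tendsto (fun n : ℕ => s * ∏ j ∈ range n, (1 + s ^ 2 / (π * (j + 1)) ^ 2)) atTop
      (𝓝 (sinh s)) := by
  have h := (Complex.tendsto_euler_sin_prod (s * Complex.I / π)).mul_const (-Complex.I)
  have hπ : (π : ℂ) ≠ 0 := by exact_mod_cast pi_ne_zero
  rw [mul_div_cancel₀ _ hπ, Complex.sin_mul_I, mul_assoc, mul_neg, Complex.I_mul_I, neg_neg,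
    mul_one, ← Complex.ofReal_sinh] at h
  rw [← Filter.tendsto_ofReal_iff]
  refine h.congr fun n => ?_
  push_cast
  rw [mul_right_comm, mul_assoc _ Complex.I, mul_neg, Complex.I_mul_I, neg_neg, mul_one]
  congr 1
  refine Finset.prod_congr rfl fun j _ => ?_
  rw [div_pow, mul_pow, Complex.I_sq, mul_pow, div_div]
  ring

theorem tendsto_euler_cosh_prod (s : ℝ) :
    Tendsto (fun n : ℕ => ∏ j ∈ range n, (1 + s ^ 2 / (π * (j + 1 / 2)) ^ 2)) atTop
      (𝓝 (cosh s)) := by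
  rcases eq_or_ne s 0 with rfl | hs
  · simp
  have hsinh : sinh s ≠ 0 := by simpa using hs
  have h2 := (tendsto_euler_sinh_prod (2 * s)).comp
    (tendsto_id.const_mul_atTop' (r := 2) two_pos : Tendsto (fun n : ℕ => 2 * n) atTop atTop)
  have h := h2.div ((tendsto_euler_sinh_prod s).const_mul 2) (mul_ne_zero two_ne_zero hsinh)
  rw [sinh_two_mul, mul_div_cancel_left₀ _ (mul_ne_zero two_ne_zero hsinh)] at h
  refine h.congr fun n => ?_
  have hpos (n : ℕ) : ∏ j ∈ range n, (1 + s ^ 2 / (π * ((j : ℝ) + 1)) ^ 2) ≠ 0 :=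
    (Finset.prod_pos fun j _ => by positivity).ne'
  have key : ∏ j ∈ range (2 * n), (1 + (2 * s) ^ 2 / (π * ((j : ℝ) + 1)) ^ 2) =
      (∏ j ∈ range n, (1 + s ^ 2 / (π * ((j : ℝ) + 1 / 2)) ^ 2)) *
        ∏ j ∈ range n, (1 + s ^ 2 / (π * ((j : ℝ) + 1)) ^ 2) := by
    induction n with
    | zero => simp
    | succ n ih =>
      rw [show 2 * (n + 1) = 2 * n + 1 + 1 by ring, prod_range_succ, prod_range_succ, ih,
        prod_range_succ, prod_range_succ]
      push_cast
      rw [show π * (2 * (n : ℝ) + 1) = 2 * (π * (n + 1 / 2)) by ring,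
        show π * (2 * (n : ℝ) + 1 + 1) = 2 * (π * (n + 1)) by ring,
        mul_pow 2 s, mul_pow 2 (π * _), mul_pow 2 (π * _),
        mul_div_mul_left _ _ (by norm_num), mul_div_mul_left _ _ (by norm_num)]
      ring
  simp only [Pi.div_apply, Function.comp_apply]
  rw [key]
  have := hpos n
  field_simp

end Real

theorem Matrix.IsCondNegDef.posSemidef_cosh_div_cosh {ι : Type*} [Fintype ι] {G : Matrix ι ι ℝ}
    (hG : G.IsCondNegDef) (h0 : ∀ a b, 0 ≤ G a b) {ν : ℝ} (hν : ν ∈ Icc (0 : ℝ) 1) :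
    (of fun a b => cosh (ν * √(G a b)) / cosh √(G a b)).PosSemidef := by
  refine posSemidef_of_tendsto
    (fun n => posSemidef_of_prod (range n) fun j _ =>
      hG.posSemidef_one_add_div h0 (c := (π * ((j : ℝ) + 1 / 2)) ^ 2) (by positivity)
        (sq_nonneg ν) (pow_le_one₀ hν.1 hν.2)) fun a b => ?_
  have h := (tendsto_euler_cosh_prod (ν * √(G a b))).div (tendsto_euler_cosh_prod √(G a b))
    (cosh_pos _).ne'
  refine h.congr fun n => ?_
  simp only [Pi.div_apply, of_apply, Finset.prod_div_distrib, mul_pow, sq_sqrt (h0 a b)]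

theorem sum_sum_dotProduct_mulVec_eq {X : Type*} {m n : ℕ}
    (C : X → X → Matrix (Fin m) (Fin m) ℝ) (x : Fin n → X) (a : Fin n → Fin m → ℝ) :
    ∑ p, ∑ q, a p ⬝ᵥ (C (x p) (x q)).mulVec (a q) =
      ∑ u : Fin n × Fin m, ∑ w : Fin n × Fin m,
        a u.1 u.2 * C (x u.1) (x w.1) u.2 w.2 * a w.1 w.2 := by
  simp only [Fintype.sum_prod_type, dotProduct, mulVec, Finset.mul_sum, mul_assoc]
  exact Finset.sum_congr rfl fun p _ => Finset.sum_comm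

theorem IsCondNegDefKernel.isCondNegDef {X : Type*} {m n : ℕ}
    {Γ : X → X → Matrix (Fin m) (Fin m) ℝ} (hΓ : IsCondNegDefKernel Γ) (x : Fin n → X) :
    (of fun u w : Fin n × Fin m => Γ (x u.1) (x w.1) u.2 w.2).IsCondNegDef := by
  refine ⟨fun u w => hΓ.1 _ _ _ _, fun v hv => ?_⟩
  have h := hΓ.2 n x (fun p i => v (p, i)) (by rwa [← Fintype.sum_prod_type])
  rwa [sum_sum_dotProduct_mulVec_eq] at h

/-- For a conditionally negative definite matrix-valued kernel `Γ` with
nonnegative entries and `ν ∈ [0,1]`, the kernel with entries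
`C_ij(x,y) = cosh(ν √γ_ij(x,y)) / cosh(√γ_ij(x,y))` is positive definite (in particular,
for `ν = 0`, the kernel with entries `1 / cosh(√γ_ij(x,y))`). -/
theorem cosh_ratio_posdef {d m : ℕ}
    (Γ : (Fin d → ℝ) → (Fin d → ℝ) → Matrix (Fin m) (Fin m) ℝ)
    (hΓ : IsCondNegDefKernel Γ) (hnn : ∀ x y i j, 0 ≤ Γ x y i j)
    (ν : ℝ) (hν : ν ∈ Icc (0:ℝ) 1) :
    IsPosDefKernel fun x y => Matrix.of fun i j =>
      Real.cosh (ν * Real.sqrt (Γ x y i j)) / Real.cosh (Real.sqrt (Γ x y i j)) := by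
  refine ⟨fun x y i j => ?_, fun n x a => ?_⟩
  · simp only [of_apply]
    rw [hΓ.1 x y i j]
  · have h := (posSemidef_iff_sum_sum_nonneg.1 ((hΓ.isCondNegDef x).posSemidef_cosh_div_cosh
      (fun _ _ => hnn _ _ _ _) hν)).2 fun u => a u.1 u.2
    exact h.trans_eq (sum_sum_dotProduct_mulVec_eq (fun x y => Matrix.of fun i j =>
      Real.cosh (ν * Real.sqrt (Γ x y i j)) / Real.cosh (Real.sqrt (Γ x y i j))) x a).symm
end
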